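/- arXiv:math/0703801 — 2 statements merged into one kernel-verified Lean document; each statement's English description precedes it below -/
import Mathlib

section
/- Let (π,U,H) be a covariant representation of (A,δ) possessing property (*), and let 𝒩_0 : C*_0(π(A),U) → B_0 be the (well-defined) map satisfying 𝒩_0(Σ_{m,n} U^{*m} π(a_{mn}) U^n) = Σ_m U^{*m} π(a_{mm}) U^m for every matrix {a_{mn}} ∈ M(A). Then for every a ∈ C*_0(π(A),U): ‖a‖ = lim_{k→∞} ‖𝒩_0[(a a*)^{2k}]‖^{1/(4k)}. -/
open Filter Topology
open scoped NNReal

noncomputable section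

variable {A : Type*} [CStarAlgebra A]

/-- The underlying set of the matrix algebra `M(A)`: matrices over `A` with finitely many
nonzero entries satisfying the entry condition `a_{ij} ∈ δ^i(1)·A·δ^j(1)`. -/
def MatMem (δ : A →⋆ₙₐ[ℂ] A) (a : ℕ → ℕ → A) : Prop :=
  ({p : ℕ × ℕ | a p.1 p.2 ≠ 0}).Finite ∧
    ∀ i j : ℕ, (⇑δ)^[i] 1 * a i j * (⇑δ)^[j] 1 = a i j

/-- The shift `Λ : Λ(a)_{ij} = δ(a_{i-1,j-1})` for `i, j ≥ 1`, and `0` otherwise. -/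
def lam (δ : A →⋆ₙₐ[ℂ] A) (a : ℕ → ℕ → A) : ℕ → ℕ → A :=
  fun i j => if i = 0 ∨ j = 0 then 0 else δ (a (i - 1) (j - 1))

/-- Ordinary (finitely supported) matrix multiplication. -/
def matMul (a b : ℕ → ℕ → A) : ℕ → ℕ → A := fun i k => ∑ᶠ j : ℕ, a i j * b j k

/-- The convolution multiplication `a ⋆ b = a·Σ_{j≥0} Λ^j(b) + Σ_{j≥1} Λ^j(a)·b`. -/
def conv (δ : A →⋆ₙₐ[ℂ] A) (a b : ℕ → ℕ → A) : ℕ → ℕ → A :=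
  fun i k => (∑ᶠ j : ℕ, matMul a ((lam δ)^[j] b) i k) +
    ∑ᶠ j : ℕ, matMul ((lam δ)^[j + 1] a) b i k

/-- The involution `(a*)_{mn} = (a_{nm})*`. -/
def mstar (a : ℕ → ℕ → A) : ℕ → ℕ → A := fun i j => star (a j i)

/-- The embedding of `A` into `M(A)` at the `(0,0)` entry. -/
def embed (a : A) : ℕ → ℕ → A := fun i j => if i = 0 ∧ j = 0 then a else 0

/-- The matrix `u`, having `δ(1)` at the `(0,1)` entry and zeros elsewhere. -/
def umat (δ : A →⋆ₙₐ[ℂ] A) : ℕ → ℕ → A := fun i j => if i = 0 ∧ j = 1 then δ 1 else 0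

/-- `⋆`-powers of a matrix (`mpow δ x 0` is the matrix unit `embed 1`). -/
def mpow (δ : A →⋆ₙₐ[ℂ] A) (x : ℕ → ℕ → A) : ℕ → ℕ → ℕ → A
  | 0 => embed 1
  | n + 1 => conv δ (mpow δ x n) x

/-- A matrix is `k`-diagonal if all entries away from the `k`-th diagonal vanish. -/
def IsDiag (k : ℤ) (a : ℕ → ℕ → A) : Prop :=
  ∀ i j : ℕ, a i j ≠ 0 → (j : ℤ) - (i : ℤ) = k

/-- The `n`-th entry `a_n^{(k)}` of the `k`-th diagonal of a matrix. -/
def diagEntry (a : ℕ → ℕ → A) (k : ℤ) (n : ℕ) : A :=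
  if 0 ≤ k then a n (n + k.toNat) else a (n + (-k).toNat) n

/-- `N_k` carries the `k`-th diagonal onto the `0`-th diagonal and deletes the rest. -/
def Nmat (a : ℕ → ℕ → A) (k : ℤ) : ℕ → ℕ → A :=
  fun i j => if i = j then diagEntry a k i else 0

variable {H : Type*} [NormedAddCommGroup H] [InnerProductSpace ℂ H] [CompleteSpace H]

/-- `(π, U, H)` is a covariant representation of `(A, δ)`. -/
def IsCovariantRep (δ : A →⋆ₙₐ[ℂ] A) (π : A →⋆ₐ[ℂ] (H →L[ℂ] H)) (U : H →L[ℂ] H) : Prop :=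
  Function.Injective π ∧ U * star U * U = U ∧
    (∀ a : A, U * π a * star U = π (δ a)) ∧
    (∀ a : A, star U * U * π a = π a * (star U * U))

/-- The map `Ψ_{(π,U)} : M(A) → B(H)`, `a ↦ Σ_{m,n} U^{*m} π(a_{mn}) U^n`. -/
def Psi (π : A →⋆ₐ[ℂ] (H →L[ℂ] H)) (U : H →L[ℂ] H) (a : ℕ → ℕ → A) : H →L[ℂ] H :=
  ∑ᶠ (m : ℕ) (n : ℕ), (star U) ^ m * π (a m n) * U ^ n

/-- Property `(*)` of a covariant representation. -/
def PropertyStar (δ : A →⋆ₙₐ[ℂ] A) (π : A →⋆ₐ[ℂ] (H →L[ℂ] H)) (U : H →L[ℂ] H) : Prop :=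
  ∀ a : ℕ → ℕ → A, MatMem δ a →
    ‖∑ᶠ m : ℕ, (star U) ^ m * π (a m m) * U ^ m‖ ≤ ‖Psi π U a‖

/-- The matrix with the single entry `z` at position `(m, n)`. -/
def matUnit (m n : ℕ) (z : A) : ℕ → ℕ → A := fun i k => if i = m ∧ k = n then z else 0

/-- The `⋆`-product of `matUnit m n x` and `matUnit p q y`. -/
def unitConv (δ : A →⋆ₙₐ[ℂ] A) (m n : ℕ) (x : A) (p q : ℕ) (y : A) : ℕ → ℕ → A :=
  if p ≤ n then matUnit m (n - p + q) (x * (⇑δ)^[n - p] y)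
  else matUnit (m + (p - n)) q ((⇑δ)^[p - n] x * y)

theorem iterate_map_star (δ : A →⋆ₙₐ[ℂ] A) (n : ℕ) (x : A) :
    (⇑δ)^[n] (star x) = star ((⇑δ)^[n] x) := by
  induction n with
  | zero => rfl
  | succ n ih => rw [Function.iterate_succ_apply', ih, map_star, Function.iterate_succ_apply']

theorem iterate_one_mul_iterate_one (δ : A →⋆ₙₐ[ℂ] A) (n : ℕ) :
    (⇑δ)^[n] 1 * (⇑δ)^[n] 1 = (⇑δ)^[n] 1 := by
  rw [← iterate_map_mul, mul_one]

theorem lam_iterate (δ : A →⋆ₙₐ[ℂ] A) (b : ℕ → ℕ → A) (j l k : ℕ) :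
    ((lam δ)^[j] b) l k = if j ≤ l ∧ j ≤ k then (⇑δ)^[j] (b (l - j) (k - j)) else 0 := by
  induction j generalizing l k with
  | zero => simp
  | succ j ih =>
    rw [Function.iterate_succ_apply', lam]
    by_cases h0 : l = 0 ∨ k = 0
    · rw [if_pos h0, if_neg (by omega)]
    · rw [if_neg h0, ih]
      by_cases h : j + 1 ≤ l ∧ j + 1 ≤ k
      · rw [if_pos h, if_pos (by omega), Function.iterate_succ_apply', Nat.sub_sub, Nat.sub_sub,
          Nat.add_comm 1 j]
      · rw [if_neg h, if_neg (by omega), map_zero]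

/-- All nonzero entries of `a` lie in the upper left `N × N` block. -/
def SupportedBelow (N : ℕ) (a : ℕ → ℕ → A) : Prop := ∀ i j, a i j ≠ 0 → i < N ∧ j < N

theorem MatMem.exists_supportedBelow {δ : A →⋆ₙₐ[ℂ] A} {a : ℕ → ℕ → A} (ha : MatMem δ a) :
    ∃ N, SupportedBelow N a := by
  obtain ⟨N, hN⟩ := (ha.1.image (fun p => p.1 + p.2)).bddAbove
  refine ⟨N + 1, fun i j hij => ?_⟩
  have := hN ⟨(i, j), hij, rfl⟩
  simp only at this
  omega

theorem SupportedBelow.mono {M N : ℕ} {a : ℕ → ℕ → A} (h : SupportedBelow M a) (hMN : M ≤ N) :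
    SupportedBelow N a := fun i j hij => by
  have := h i j hij
  omega

theorem finsum_eq_sum_range {M : Type*} [AddCommMonoid M] (N : ℕ) (f : ℕ → M)
    (h : ∀ i, N ≤ i → f i = 0) : ∑ᶠ i, f i = ∑ i ∈ Finset.range N, f i := by
  refine finsum_eq_sum_of_support_subset f fun i hi => ?_
  by_contra hN
  exact hi (h i (by simpa using hN))

theorem SupportedBelow.conv_eq_sum {N : ℕ} {a b : ℕ → ℕ → A} (δ : A →⋆ₙₐ[ℂ] A)
    (ha : SupportedBelow N a) (hb : SupportedBelow N b) :
    conv δ a b = ∑ m ∈ Finset.range N, ∑ n ∈ Finset.range N, ∑ p ∈ Finset.range N,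
      ∑ q ∈ Finset.range N, unitConv δ m n (a m n) p q (b p q) := by
  have ha0 : ∀ i j, N ≤ i ∨ N ≤ j → a i j = 0 := fun i j hij => by
    by_contra hne
    have := ha i j hne
    omega
  have hb0 : ∀ i j, N ≤ i ∨ N ≤ j → b i j = 0 := fun i j hij => by
    by_contra hne
    have := hb i j hne
    omega
  ext i k
  have h1 : ∑ᶠ j : ℕ, matMul a ((lam δ)^[j] b) i k = ∑ n ∈ Finset.range N,
      ∑ p ∈ Finset.range N, if p ≤ n ∧ n - p ≤ k then
        a i n * (⇑δ)^[n - p] (b p (k - (n - p))) else 0 := by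
    rw [finsum_eq_sum_range N]
    · have : ∀ j, matMul a ((lam δ)^[j] b) i k = ∑ n ∈ Finset.range N,
          a i n * ((lam δ)^[j] b) n k := fun j =>
        finsum_eq_sum_range N _ fun n hn => by rw [ha0 i n (Or.inr hn), zero_mul]
      simp_rw [this]
      rw [Finset.sum_comm]
      refine Finset.sum_congr rfl fun n hn => ?_
      have hn' : n + 1 ≤ N := Finset.mem_range.1 hn
      have hsub : Finset.range (n + 1) ⊆ Finset.range N := Finset.range_mono hn'
      rw [← Finset.sum_subset hsub, ← Finset.sum_subset hsub, ← Finset.sum_range_reflect]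
      · refine Finset.sum_congr rfl fun p hp => ?_
        have hp' : p ≤ n := by simpa [Nat.lt_succ_iff] using hp
        rw [lam_iterate, show n + 1 - 1 - p = n - p by omega, show n - (n - p) = p by omega]
        by_cases hk : n - p ≤ k
        · rw [if_pos ⟨by omega, hk⟩, if_pos ⟨hp', hk⟩]
        · rw [if_neg (fun h => hk h.2), if_neg (fun h => hk h.2), mul_zero]
      · intro p _ hp
        rw [if_neg]
        simp at hp
        omega
      · intro p _ hp
        rw [lam_iterate, if_neg, mul_zero]
        simp at hp
        omega
    · intro j hj
      refine finsum_eq_zero_of_forall_eq_zero fun n => ?_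
      by_cases hn : N ≤ n
      · rw [ha0 i n (Or.inr hn), zero_mul]
      · rw [lam_iterate, if_neg (by omega), mul_zero]
  have h2 : ∑ᶠ j : ℕ, matMul ((lam δ)^[j + 1] a) b i k = ∑ p ∈ Finset.range N,
      ∑ n ∈ Finset.range N, if ¬ p ≤ n ∧ p - n ≤ i then
        (⇑δ)^[p - n] (a (i - (p - n)) n) * b p k else 0 := by
    rw [finsum_eq_sum_range N]
    · have : ∀ j, matMul ((lam δ)^[j + 1] a) b i k = ∑ p ∈ Finset.range N,
          ((lam δ)^[j + 1] a) i p * b p k := fun j =>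
        finsum_eq_sum_range N _ fun n hn => by rw [hb0 n k (Or.inl hn), mul_zero]
      simp_rw [this]
      rw [Finset.sum_comm]
      refine Finset.sum_congr rfl fun p hp => ?_
      have hp' : p ≤ N := (Finset.mem_range.1 hp).le
      have hsub : Finset.range p ⊆ Finset.range N := Finset.range_mono hp'
      rw [← Finset.sum_subset hsub, ← Finset.sum_subset hsub, ← Finset.sum_range_reflect]
      · refine Finset.sum_congr rfl fun n hn => ?_
        have hn' : n < p := by simpa using hn
        rw [lam_iterate, show p - 1 - n + 1 = p - n by omega, show p - (p - n) = n by omega]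
        by_cases hk : p - n ≤ i
        · rw [if_pos ⟨hk, by omega⟩, if_pos ⟨by omega, hk⟩]
        · rw [if_neg (fun h => hk h.1), if_neg (fun h => hk h.2), zero_mul]
      · intro n _ hn
        rw [if_neg]
        simp at hn
        omega
      · intro n _ hn
        rw [lam_iterate, if_neg, zero_mul]
        simp at hn
        omega
    · intro j hj
      refine finsum_eq_zero_of_forall_eq_zero fun p => ?_
      by_cases hp : N ≤ p
      · rw [hb0 p k (Or.inl hp), mul_zero]
      · rw [lam_iterate, if_neg (by omega), zero_mul]
  have e1 : ∀ n p, (if p ≤ n ∧ n - p ≤ k then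
        a i n * (⇑δ)^[n - p] (b p (k - (n - p))) else 0) = ∑ m ∈ Finset.range N,
        ∑ q ∈ Finset.range N, if p ≤ n then
          matUnit m (n - p + q) (a m n * (⇑δ)^[n - p] (b p q)) i k else 0 := by
    intro n p
    by_cases hpn : p ≤ n
    · simp only [hpn, true_and, if_true, matUnit, ite_and]
      simp only [Finset.sum_ite_irrel, Finset.sum_ite_eq, Finset.sum_const_zero, Finset.mem_range]
      by_cases hi : i < N
      · rw [if_pos hi]
        by_cases hk : n - p ≤ k
        · have : ∀ q, k = n - p + q ↔ k - (n - p) = q := by omega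
          simp only [this, Finset.sum_ite_eq, Finset.mem_range, if_pos hk]
          split_ifs with hq
          · rfl
          · rw [hb0 _ _ (Or.inr (not_lt.1 hq)), iterate_map_zero, mul_zero]
        · rw [if_neg hk, Finset.sum_eq_zero]
          intro q _
          rw [if_neg (by omega)]
      · rw [if_neg hi, ha0 _ _ (Or.inl (not_lt.1 hi)), zero_mul, ite_self]
    · simp [hpn]
  have e2 : ∀ n p, (if ¬ p ≤ n ∧ p - n ≤ i then
        (⇑δ)^[p - n] (a (i - (p - n)) n) * b p k else 0) = ∑ m ∈ Finset.range N,
        ∑ q ∈ Finset.range N, if p ≤ n then 0 else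
          matUnit (m + (p - n)) q ((⇑δ)^[p - n] (a m n) * b p q) i k := by
    intro n p
    by_cases hpn : p ≤ n
    · simp [hpn]
    · simp only [hpn, not_false_eq_true, true_and, if_false, matUnit, ite_and]
      simp only [Finset.sum_ite_irrel, Finset.sum_ite_eq, Finset.sum_const_zero, Finset.mem_range]
      by_cases hk : k < N
      · simp only [if_pos hk]
        by_cases hi : p - n ≤ i
        · have : ∀ q, i = q + (p - n) ↔ i - (p - n) = q := by omega
          simp only [this, Finset.sum_ite_eq, Finset.mem_range, if_pos hi]
          split_ifs with hq
          · rfl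
          · rw [ha0 _ _ (Or.inl (not_lt.1 hq)), iterate_map_zero, zero_mul]
        · rw [if_neg hi, Finset.sum_eq_zero]
          intro q _
          rw [if_neg (by omega)]
      · simp [hb0 _ _ (Or.inr (not_lt.1 hk))]
  rw [conv, h1, h2, Finset.sum_comm (s := Finset.range N) (t := Finset.range N)
    (f := fun p n => if ¬ p ≤ n ∧ p - n ≤ i then
        (⇑δ)^[p - n] (a (i - (p - n)) n) * b p k else 0)]
  simp_rw [e1, e2, ← Finset.sum_add_distrib]
  simp only [Finset.sum_apply]
  rw [Finset.sum_comm (s := Finset.range N) (t := Finset.range N)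
    (f := fun m n => ∑ p ∈ Finset.range N,
      ∑ q ∈ Finset.range N, unitConv δ m n (a m n) p q (b p q) i k)]
  refine Finset.sum_congr rfl fun n _ => ?_
  rw [Finset.sum_comm]
  refine Finset.sum_congr rfl fun p _ => Finset.sum_congr rfl fun m _ =>
    Finset.sum_congr rfl fun q _ => ?_
  unfold unitConv
  split_ifs <;> simp

/-- The entry condition at position `(m, n)`. -/
def EntryMem (δ : A →⋆ₙₐ[ℂ] A) (m n : ℕ) (z : A) : Prop :=
  (⇑δ)^[m] 1 * z * (⇑δ)^[n] 1 = z

theorem EntryMem.left {δ : A →⋆ₙₐ[ℂ] A} {m n : ℕ} {z : A} (h : EntryMem δ m n z) :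
    (⇑δ)^[m] 1 * z = z := by
  rw [← h, ← mul_assoc, ← mul_assoc, iterate_one_mul_iterate_one]

theorem EntryMem.right {δ : A →⋆ₙₐ[ℂ] A} {m n : ℕ} {z : A} (h : EntryMem δ m n z) :
    z * (⇑δ)^[n] 1 = z := by
  rw [← h, mul_assoc, iterate_one_mul_iterate_one]

theorem EntryMem.of_left_right {δ : A →⋆ₙₐ[ℂ] A} {m n : ℕ} {z : A}
    (hl : (⇑δ)^[m] 1 * z = z) (hr : z * (⇑δ)^[n] 1 = z) : EntryMem δ m n z := by
  rw [EntryMem, hl, hr]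

theorem EntryMem.star {δ : A →⋆ₙₐ[ℂ] A} {m n : ℕ} {z : A} (h : EntryMem δ m n z) :
    EntryMem δ n m (star z) := by
  have h1 : ∀ n, (⇑δ)^[n] 1 = Star.star ((⇑δ)^[n] 1) := fun n => by
    rw [← iterate_map_star, star_one]
  refine .of_left_right ?_ ?_
  · rw [h1, ← star_mul, h.right]
  · rw [h1, ← star_mul, h.left]

theorem EntryMem.mul_iterate {δ : A →⋆ₙₐ[ℂ] A} {m j p q : ℕ} {x y : A}
    (hx : EntryMem δ m (p + j) x) (hy : EntryMem δ p q y) :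
    EntryMem δ m (j + q) (x * (⇑δ)^[j] y) := by
  refine .of_left_right ?_ ?_
  · rw [← mul_assoc, hx.left]
  · rw [mul_assoc, Function.iterate_add_apply, ← iterate_map_mul, hy.right]

theorem EntryMem.iterate_mul {δ : A →⋆ₙₐ[ℂ] A} {m n j q : ℕ} {x y : A}
    (hx : EntryMem δ m n x) (hy : EntryMem δ (n + j) q y) :
    EntryMem δ (m + j) q ((⇑δ)^[j] x * y) := by
  refine .of_left_right ?_ ?_
  · rw [← mul_assoc, Nat.add_comm, Function.iterate_add_apply, ← iterate_map_mul, hx.left]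
  · rw [mul_assoc, hy.right]

/-- The matrices in `M(A)` form a linear subspace. -/
def matSubmodule (δ : A →⋆ₙₐ[ℂ] A) : Submodule ℂ (ℕ → ℕ → A) where
  carrier := {a | MatMem δ a}
  add_mem' := by
    rintro a b ⟨ha, ha'⟩ ⟨hb, hb'⟩
    refine ⟨(ha.union hb).subset fun p hp => ?_, fun i j => ?_⟩
    · by_contra h
      simp only [Set.mem_union, Set.mem_ofPred_eq, not_or, not_not] at h
      exact hp (by simp [h.1, h.2])
    · simp only [Pi.add_apply, mul_add, add_mul, ha', hb']
  zero_mem' := ⟨by simp, by simp⟩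
  smul_mem' := by
    rintro c a ⟨ha, ha'⟩
    refine ⟨ha.subset fun p hp h => hp ?_, fun i j => ?_⟩
    · simp [h]
    · simp only [Pi.smul_apply, mul_smul_comm, smul_mul_assoc, ha']

theorem mem_matSubmodule {δ : A →⋆ₙₐ[ℂ] A} {a : ℕ → ℕ → A} :
    a ∈ matSubmodule δ ↔ MatMem δ a := Iff.rfl

theorem EntryMem.matUnit_mem {δ : A →⋆ₙₐ[ℂ] A} {m n : ℕ} {z : A} (h : EntryMem δ m n z) :
    MatMem δ (matUnit m n z) := by
  refine ⟨(Set.finite_singleton (m, n)).subset fun p hp => ?_, fun i j => ?_⟩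
  · by_contra hne
    exact hp (if_neg fun h => hne (Prod.ext h.1 h.2))
  · unfold matUnit
    split_ifs with hij
    · rw [hij.1, hij.2]
      exact h
    · simp

theorem EntryMem.unitConv_mem {δ : A →⋆ₙₐ[ℂ] A} {m n p q : ℕ} {x y : A}
    (hx : EntryMem δ m n x) (hy : EntryMem δ p q y) : MatMem δ (unitConv δ m n x p q y) := by
  unfold unitConv
  split_ifs with h
  · obtain ⟨j, rfl⟩ := Nat.exists_eq_add_of_le h
    rw [Nat.add_sub_cancel_left]
    exact (hx.mul_iterate hy).matUnit_mem
  · obtain ⟨j, rfl⟩ := Nat.exists_eq_add_of_le (not_le.1 h).le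
    rw [Nat.add_sub_cancel_left]
    exact (hx.iterate_mul hy).matUnit_mem

theorem MatMem.conv {δ : A →⋆ₙₐ[ℂ] A} {a b : ℕ → ℕ → A} (ha : MatMem δ a) (hb : MatMem δ b) :
    MatMem δ (conv δ a b) := by
  obtain ⟨M, hM⟩ := ha.exists_supportedBelow
  obtain ⟨N, hN⟩ := hb.exists_supportedBelow
  rw [(hM.mono (le_max_left M N)).conv_eq_sum δ (hN.mono (le_max_right M N)),
    ← mem_matSubmodule]
  exact sum_mem fun m _ => sum_mem fun n _ => sum_mem fun p _ => sum_mem fun q _ =>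
    EntryMem.unitConv_mem (ha.2 m n) (hb.2 p q)

theorem MatMem.mstar {δ : A →⋆ₙₐ[ℂ] A} {a : ℕ → ℕ → A} (ha : MatMem δ a) :
    MatMem δ (mstar a) := by
  refine ⟨(ha.1.image Prod.swap).subset fun p hp => ⟨p.swap, fun h => hp ?_, p.swap_swap⟩,
    fun i j => EntryMem.star (ha.2 j i)⟩
  simp only [Prod.fst_swap, Prod.snd_swap] at h
  simp [_root_.mstar, h]

theorem matMem_embed_one (δ : A →⋆ₙₐ[ℂ] A) : MatMem δ (embed 1) :=
  EntryMem.matUnit_mem (m := 0) (n := 0) (by simp [EntryMem])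

theorem MatMem.mpow {δ : A →⋆ₙₐ[ℂ] A} {a : ℕ → ℕ → A} (ha : MatMem δ a) (n : ℕ) :
    MatMem δ (mpow δ a n) := by
  induction n with
  | zero => exact matMem_embed_one δ
  | succ n ih => exact ih.conv ha

section Operators

variable (π : A →⋆ₐ[ℂ] (H →L[ℂ] H)) (U : H →L[ℂ] H)

theorem SupportedBelow.psi_eq_sum {N : ℕ} {a : ℕ → ℕ → A} (h : SupportedBelow N a) :
    Psi π U a = ∑ m ∈ Finset.range N, ∑ n ∈ Finset.range N,
      (star U) ^ m * π (a m n) * U ^ n := by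
  have h0 : ∀ i j, N ≤ i ∨ N ≤ j → a i j = 0 := fun i j hij => by
    by_contra hne
    have := h i j hne
    omega
  have : ∀ m, ∑ᶠ n : ℕ, (star U) ^ m * π (a m n) * U ^ n =
      ∑ n ∈ Finset.range N, (star U) ^ m * π (a m n) * U ^ n := fun m =>
    finsum_eq_sum_range N _ fun n hn => by simp [h0 m n (Or.inr hn)]
  rw [Psi]
  simp_rw [this]
  exact finsum_eq_sum_range N _ fun m hm => Finset.sum_eq_zero fun n _ => by
    simp [h0 m n (Or.inl hm)]

theorem SupportedBelow.diag_eq_sum {N : ℕ} {a : ℕ → ℕ → A} (h : SupportedBelow N a) :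
    ∑ᶠ m : ℕ, (star U) ^ m * π (a m m) * U ^ m = ∑ m ∈ Finset.range N,
      (star U) ^ m * π (a m m) * U ^ m :=
  finsum_eq_sum_range N _ fun m hm => by
    by_cases h0 : a m m = 0
    · simp [h0]
    · have := h m m h0
      omega

theorem psi_matUnit (m n : ℕ) (z : A) :
    Psi π U (matUnit m n z) = (star U) ^ m * π z * U ^ n := by
  have h : SupportedBelow (m + n + 1) (matUnit m n z) := fun i j hij => by
    by_contra hne
    exact hij (if_neg (by omega))
  rw [h.psi_eq_sum, Finset.sum_eq_single m, Finset.sum_eq_single n]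
  · simp [matUnit]
  · intro k _ hk
    simp [matUnit, hk]
  · intro hn
    simp at hn
  · intro k _ hk
    simp [matUnit, hk]
  · intro hn
    simp at hn

theorem psi_add {δ : A →⋆ₙₐ[ℂ] A} {a b : ℕ → ℕ → A} (ha : MatMem δ a) (hb : MatMem δ b) :
    Psi π U (a + b) = Psi π U a + Psi π U b := by
  obtain ⟨M, hM⟩ := ha.exists_supportedBelow
  obtain ⟨N, hN⟩ := hb.exists_supportedBelow
  have hM' := hM.mono (le_max_left M N)
  have hN' := hN.mono (le_max_right M N)
  have hab : SupportedBelow (max M N) (a + b) := fun i j hij => by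
    by_cases h : a i j = 0
    · exact hN' i j fun h' => hij (by simp [h, h'])
    · exact hM' i j h
  simp only [hM'.psi_eq_sum, hN'.psi_eq_sum, hab.psi_eq_sum, Pi.add_apply, map_add, mul_add,
    add_mul, Finset.sum_add_distrib]

theorem psi_smul {δ : A →⋆ₙₐ[ℂ] A} {a : ℕ → ℕ → A} (c : ℂ) (ha : MatMem δ a) :
    Psi π U (c • a) = c • Psi π U a := by
  obtain ⟨N, hN⟩ := ha.exists_supportedBelow
  have hc : SupportedBelow N (c • a) := fun i j hij => hN i j fun h => hij (by simp [h])
  simp only [hN.psi_eq_sum, hc.psi_eq_sum, Pi.smul_apply, map_smul, mul_smul_comm,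
    smul_mul_assoc, Finset.smul_sum]

theorem psi_zero : Psi π U (0 : ℕ → ℕ → A) = 0 := by
  simp [Psi]

theorem psi_sum {δ : A →⋆ₙₐ[ℂ] A} {ι : Type*} (s : Finset ι) (f : ι → ℕ → ℕ → A)
    (hf : ∀ i ∈ s, MatMem δ (f i)) : Psi π U (∑ i ∈ s, f i) = ∑ i ∈ s, Psi π U (f i) := by
  classical
  induction s using Finset.induction_on with
  | empty => simp [psi_zero]
  | insert i s hi ih =>
    rw [Finset.sum_insert hi, Finset.sum_insert hi, psi_add π U (hf i (by simp))
      (mem_matSubmodule.1 (sum_mem fun j hj => hf j (by simp [hj]))),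
      ih fun j hj => hf j (by simp [hj])]

theorem psi_mstar {δ : A →⋆ₙₐ[ℂ] A} {a : ℕ → ℕ → A} (ha : MatMem δ a) :
    Psi π U (mstar a) = star (Psi π U a) := by
  obtain ⟨N, hN⟩ := ha.exists_supportedBelow
  have hN' : SupportedBelow N (mstar a) := fun i j hij =>
    (hN j i fun h => hij (by simp [mstar, h])).symm
  rw [hN.psi_eq_sum, hN'.psi_eq_sum, Finset.sum_comm]
  simp only [star_sum, star_mul, star_pow, star_star, mstar, map_star, mul_assoc]

theorem psi_embed_one : Psi π U (embed (1 : A)) = 1 := by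
  exact (psi_matUnit π U 0 0 1).trans (by simp)

variable {π U} {δ : A →⋆ₙₐ[ℂ] A}

theorem IsCovariantRep.pow_mul_map (h : IsCovariantRep δ π U) (n : ℕ) (a : A) :
    U ^ n * π a = π ((⇑δ)^[n] a) * U ^ n := by
  obtain ⟨-, hU, hδ, hc⟩ := h
  have h1 : ∀ a, U * π a = π (δ a) * U := fun a => by
    calc U * π a = U * (star U * U * π a) := by rw [← mul_assoc, ← mul_assoc, hU]
      _ = π (δ a) * U := by rw [hc, ← hδ]; simp only [mul_assoc]
  induction n with
  | zero => simp
  | succ n ih =>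
    rw [pow_succ', mul_assoc, ih, ← mul_assoc, h1, Function.iterate_succ_apply', mul_assoc]

theorem IsCovariantRep.map_mul_star_pow (h : IsCovariantRep δ π U) (n : ℕ) (a : A) :
    π a * star U ^ n = star U ^ n * π ((⇑δ)^[n] a) := by
  have := congrArg star (h.pow_mul_map n (star a))
  simpa [iterate_map_star, ← map_star] using this

theorem IsCovariantRep.pow_mul_star_pow (h : IsCovariantRep δ π U) (n : ℕ) :
    U ^ n * star U ^ n = π ((⇑δ)^[n] 1) := by
  induction n with
  | zero => simp
  | succ n ih =>
    rw [pow_succ', pow_succ, mul_assoc, ← mul_assoc (U ^ n), ih, ← mul_assoc, h.2.2.1,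
      Function.iterate_succ_apply']

theorem IsCovariantRep.unit_mul_unit (h : IsCovariantRep δ π U) {m n p q : ℕ} {x y : A}
    (hx : EntryMem δ m n x) (hy : EntryMem δ p q y) :
    (star U ^ m * π x * U ^ n) * (star U ^ p * π y * U ^ q) =
      Psi π U (unitConv δ m n x p q y) := by
  unfold unitConv
  split_ifs with hpn
  · obtain ⟨j, rfl⟩ := Nat.exists_eq_add_of_le hpn
    rw [Nat.add_sub_cancel_left, psi_matUnit]
    calc _ = star U ^ m * π x * U ^ j * (U ^ p * star U ^ p) * π y * U ^ q := by
          rw [Nat.add_comm p j, pow_add]; simp only [mul_assoc]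
      _ = star U ^ m * π x * (U ^ j * π ((⇑δ)^[p] 1 * y)) * U ^ q := by
          rw [h.pow_mul_star_pow, map_mul]; simp only [mul_assoc]
      _ = _ := by
          rw [hy.left, h.pow_mul_map, map_mul, pow_add]; simp only [mul_assoc]
  · obtain ⟨j, rfl⟩ := Nat.exists_eq_add_of_le (not_le.1 hpn).le
    rw [Nat.add_sub_cancel_left, psi_matUnit]
    calc _ = star U ^ m * π x * (U ^ n * star U ^ n) * star U ^ j * π y * U ^ q := by
          rw [pow_add]; simp only [mul_assoc]
      _ = star U ^ m * (π (x * (⇑δ)^[n] 1) * star U ^ j) * π y * U ^ q := by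
          rw [h.pow_mul_star_pow, map_mul]; simp only [mul_assoc]
      _ = _ := by
          rw [hx.right, h.map_mul_star_pow, map_mul, pow_add]; simp only [mul_assoc]

theorem IsCovariantRep.psi_conv (h : IsCovariantRep δ π U) {a b : ℕ → ℕ → A}
    (ha : MatMem δ a) (hb : MatMem δ b) : Psi π U (conv δ a b) = Psi π U a * Psi π U b := by
  obtain ⟨M, hM⟩ := ha.exists_supportedBelow
  obtain ⟨N, hN⟩ := hb.exists_supportedBelow
  have hM' := hM.mono (le_max_left M N)
  have hN' := hN.mono (le_max_right M N)
  have hmem : ∀ m n p q, MatMem δ (unitConv δ m n (a m n) p q (b p q)) := fun m n p q =>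
    EntryMem.unitConv_mem (ha.2 m n) (hb.2 p q)
  rw [hM'.conv_eq_sum δ hN', hM'.psi_eq_sum, hN'.psi_eq_sum, Finset.sum_mul]
  rw [psi_sum π U (δ := δ) _ _ fun m _ => sum_mem (S := matSubmodule δ) fun n _ =>
    sum_mem fun p _ => sum_mem fun q _ => hmem m n p q]
  refine Finset.sum_congr rfl fun m _ => ?_
  rw [psi_sum π U (δ := δ) _ _ fun n _ => sum_mem (S := matSubmodule δ) fun p _ =>
    sum_mem fun q _ => hmem m n p q, Finset.sum_mul]
  refine Finset.sum_congr rfl fun n _ => ?_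
  rw [psi_sum π U (δ := δ) _ _ fun p _ => sum_mem (S := matSubmodule δ) fun q _ => hmem m n p q,
    Finset.mul_sum]
  refine Finset.sum_congr rfl fun p _ => ?_
  rw [psi_sum π U (δ := δ) _ _ fun q _ => hmem m n p q, Finset.mul_sum]
  exact Finset.sum_congr rfl fun q _ => (h.unit_mul_unit (ha.2 m n) (hb.2 p q)).symm

theorem IsCovariantRep.psi_mpow (h : IsCovariantRep δ π U) {a : ℕ → ℕ → A} (ha : MatMem δ a)
    (n : ℕ) : Psi π U (mpow δ a n) = Psi π U a ^ n := by
  induction n with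
  | zero => simp [mpow, psi_embed_one]
  | succ n ih => rw [mpow, h.psi_conv (ha.mpow n) ha, ih, pow_succ]

variable (π U δ) in
/-- The operators of degree `j`: combinations of `U^{*m} π(z) U^n` with `n - m = j`. -/
def degSubmodule (j : ℤ) : Submodule ℂ (H →L[ℂ] H) :=
  Submodule.span ℂ {t | ∃ (m n : ℕ) (z : A), (n : ℤ) - m = j ∧ EntryMem δ m n z ∧
    t = star U ^ m * π z * U ^ n}

theorem term_mem_degSubmodule {m n : ℕ} {z : A} (hz : EntryMem δ m n z) :
    star U ^ m * π z * U ^ n ∈ degSubmodule π U δ ((n : ℤ) - m) :=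
  Submodule.subset_span ⟨m, n, z, rfl, hz, rfl⟩

theorem IsCovariantRep.degSubmodule_mul_le (h : IsCovariantRep δ π U) (i j : ℤ) :
    degSubmodule π U δ i * degSubmodule π U δ j ≤ degSubmodule π U δ (i + j) := by
  rw [degSubmodule, degSubmodule, Submodule.span_mul_span, Submodule.span_le]
  rintro _ ⟨_, ⟨m, n, x, rfl, hx, rfl⟩, _, ⟨p, q, y, rfl, hy, rfl⟩, rfl⟩
  simp only [SetLike.mem_coe]
  rw [h.unit_mul_unit hx hy, unitConv]
  split_ifs with hpn
  · obtain ⟨k, rfl⟩ := Nat.exists_eq_add_of_le hpn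
    rw [Nat.add_sub_cancel_left, psi_matUnit]
    convert! term_mem_degSubmodule (hx.mul_iterate hy) using 2
    push_cast
    ring
  · obtain ⟨k, rfl⟩ := Nat.exists_eq_add_of_le (not_le.1 hpn).le
    rw [Nat.add_sub_cancel_left, psi_matUnit]
    convert! term_mem_degSubmodule (hx.iterate_mul hy) using 2
    push_cast
    ring

theorem star_mem_degSubmodule {j : ℤ} {t : H →L[ℂ] H} (ht : t ∈ degSubmodule π U δ j) :
    star t ∈ degSubmodule π U δ (-j) := by
  induction ht using Submodule.span_induction with
  | mem t ht =>
    obtain ⟨m, n, z, rfl, hz, rfl⟩ := ht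
    convert! term_mem_degSubmodule (π := π) (U := U) hz.star using 1
    · rw [neg_sub]
    · simp [mul_assoc, map_star]
  | zero => simp
  | add s t _ _ hs ht => simpa using add_mem hs ht
  | smul c t _ ht => simpa using Submodule.smul_mem _ (star c) ht

variable (π U δ) in
/-- The operators all of whose homogeneous parts have degree of modulus at most `W`. -/
def degLE (W : ℕ) : Submodule ℂ (H →L[ℂ] H) :=
  ⨆ j ∈ Finset.Icc (-(W : ℤ)) W, degSubmodule π U δ j

theorem degSubmodule_le_degLE {W : ℕ} {j : ℤ} (h : |j| ≤ W) :
    degSubmodule π U δ j ≤ degLE π U δ W :=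
  le_iSup₂_of_le j (Finset.mem_Icc.2 (abs_le.1 h)) le_rfl

theorem mem_degLE {W : ℕ} {t : H →L[ℂ] H} : t ∈ degLE π U δ W ↔
    ∃ d : ℤ → H →L[ℂ] H, (∀ j, d j ∈ degSubmodule π U δ j) ∧
      ∑ j ∈ Finset.Icc (-(W : ℤ)) W, d j = t := by
  rw [degLE, Submodule.mem_iSup_finset_iff_exists_sum]
  exact ⟨fun ⟨d, hd⟩ => ⟨fun j => d j, fun j => (d j).2, hd⟩,
    fun ⟨d, hd, h⟩ => ⟨fun j => ⟨d j, hd j⟩, h⟩⟩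

theorem IsCovariantRep.degLE_mul_le (h : IsCovariantRep δ π U) (V W : ℕ) :
    degLE π U δ V * degLE π U δ W ≤ degLE π U δ (V + W) := by
  simp only [degLE, Submodule.iSup_mul, Submodule.mul_iSup, iSup_le_iff]
  intro j hj i hi
  refine (h.degSubmodule_mul_le _ _).trans (degSubmodule_le_degLE ?_)
  simp only [Finset.mem_Icc] at hi hj
  rw [abs_le]
  push_cast
  omega

theorem star_mem_degLE {W : ℕ} {t : H →L[ℂ] H} (ht : t ∈ degLE π U δ W) :
    star t ∈ degLE π U δ W := by
  obtain ⟨d, hd, rfl⟩ := mem_degLE.1 ht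
  rw [star_sum]
  refine sum_mem fun j hj => degSubmodule_le_degLE ?_ (star_mem_degSubmodule (hd j))
  rw [abs_neg, abs_le]
  exact Finset.mem_Icc.1 hj

theorem IsCovariantRep.pow_mem_degLE (h : IsCovariantRep δ π U) {W : ℕ} {t : H →L[ℂ] H}
    (ht : t ∈ degLE π U δ W) (n : ℕ) : t ^ n ∈ degLE π U δ (W * n) := by
  induction n with
  | zero =>
    refine degSubmodule_le_degLE (j := 0) (by simp) ?_
    simpa using term_mem_degSubmodule (π := π) (U := U) (δ := δ) (m := 0) (n := 0) (z := 1)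
      (by simp [EntryMem])
  | succ n ih =>
    rw [pow_succ, Nat.mul_succ]
    exact h.degLE_mul_le _ _ (Submodule.mul_mem_mul ih ht)

/-- Splitting of `Psi π U b` into homogeneous parts. -/
theorem MatMem.exists_decomposition {b : ℕ → ℕ → A} (hb : MatMem δ b) :
    ∃ (N : ℕ) (d : ℤ → H →L[ℂ] H), (∀ j, d j ∈ degSubmodule π U δ j) ∧
      ∑ j ∈ Finset.Icc (-(N : ℤ)) N, d j = Psi π U b ∧ d 0 = Psi π U (Nmat b 0) := by
  obtain ⟨N, hN⟩ := hb.exists_supportedBelow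
  have hN' : SupportedBelow N (Nmat b 0) := fun i j hij => by
    by_cases h : i = j
    · subst h
      exact hN i i fun h0 => hij (by simp [Nmat, diagEntry, h0])
    · exact absurd (if_neg h) hij
  refine ⟨N, fun j => ∑ m ∈ Finset.range N, ∑ n ∈ Finset.range N,
    if (n : ℤ) - m = j then star U ^ m * π (b m n) * U ^ n else 0, fun j => ?_, ?_, ?_⟩
  · refine sum_mem fun m _ => sum_mem fun n _ => ?_
    split_ifs with h
    · exact h ▸ term_mem_degSubmodule (hb.2 m n)
    · exact zero_mem _
  · rw [hN.psi_eq_sum, Finset.sum_comm]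
    refine Finset.sum_congr rfl fun m hm => ?_
    rw [Finset.sum_comm]
    refine Finset.sum_congr rfl fun n hn => ?_
    rw [Finset.sum_ite_eq, if_pos]
    simp only [Finset.mem_range, Finset.mem_Icc] at hm hn ⊢
    omega
  · rw [hN'.psi_eq_sum]
    refine Finset.sum_congr rfl fun m hm => Finset.sum_congr rfl fun n hn => ?_
    by_cases h : m = n
    · simp [h, Nmat, diagEntry]
    · rw [if_neg (by omega), Nmat, if_neg h, map_zero, mul_zero, zero_mul]

theorem nmat_zero_apply (b : ℕ → ℕ → A) (i j : ℕ) :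
    Nmat b 0 i j = if i = j then b i j else 0 := by
  by_cases h : i = j <;> simp [Nmat, diagEntry, h]

theorem nmat_sum {ι : Type*} (s : Finset ι) (f : ι → ℕ → ℕ → A) :
    Nmat (∑ i ∈ s, f i) 0 = ∑ i ∈ s, Nmat (f i) 0 := by
  ext i j
  simp only [nmat_zero_apply, Finset.sum_apply]
  split_ifs <;> simp

theorem MatMem.nmat {b : ℕ → ℕ → A} (hb : MatMem δ b) : MatMem δ (Nmat b 0) := by
  refine ⟨hb.1.subset fun p hp h => hp ?_, fun i j => ?_⟩
  · simp [nmat_zero_apply, h]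
  · rw [nmat_zero_apply]
    split_ifs
    · exact hb.2 i j
    · simp

theorem MatMem.psi_nmat {b : ℕ → ℕ → A} (hb : MatMem δ b) :
    Psi π U (Nmat b 0) = ∑ᶠ m : ℕ, (star U) ^ m * π (b m m) * U ^ m := by
  obtain ⟨M, hM⟩ := hb.exists_supportedBelow
  obtain ⟨N, hN⟩ := hb.nmat.exists_supportedBelow
  rw [(hN.mono (le_max_right M N)).psi_eq_sum, (hM.mono (le_max_left M N)).diag_eq_sum]
  refine Finset.sum_congr rfl fun m hm => ?_
  rw [Finset.sum_eq_single_of_mem m hm, nmat_zero_apply, if_pos rfl]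
  intro n _ hn
  simp [nmat_zero_apply, hn.symm]

variable (π U) in
theorem exists_psi_eq_of_mem_degSubmodule {j : ℤ} {t : H →L[ℂ] H}
    (ht : t ∈ degSubmodule π U δ j) :
    ∃ b, MatMem δ b ∧ Psi π U b = t ∧ Psi π U (Nmat b 0) = if j = 0 then t else 0 := by
  induction ht using Submodule.span_induction with
  | mem t ht =>
    obtain ⟨m, n, z, rfl, hz, rfl⟩ := ht
    refine ⟨matUnit m n z, hz.matUnit_mem, psi_matUnit π U m n z, ?_⟩
    have h : Nmat (matUnit m n z) 0 = if (n : ℤ) - m = 0 then matUnit m n z else 0 := by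
      ext i k
      rw [nmat_zero_apply]
      by_cases hmn : (n : ℤ) - m = 0
      · rw [if_pos hmn]
        by_cases hik : i = k
        · rw [if_pos hik]
        · rw [if_neg hik]
          exact (if_neg (by omega)).symm
      · rw [if_neg hmn]
        split_ifs
        · exact if_neg (by omega)
        · rfl
    rw [h, apply_ite (Psi π U), psi_matUnit, psi_zero]
  | zero =>
    have h : Nmat (0 : ℕ → ℕ → A) 0 = 0 := by ext i k; simp [nmat_zero_apply]
    exact ⟨0, zero_mem (matSubmodule δ), psi_zero π U, by rw [h, psi_zero, ite_self]⟩
  | add s t _ _ hs ht =>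
    obtain ⟨b, hb, rfl, hbs⟩ := hs
    obtain ⟨c, hc, rfl, hct⟩ := ht
    have h : Nmat (b + c) 0 = Nmat b 0 + Nmat c 0 := by
      ext i k
      simp only [nmat_zero_apply, Pi.add_apply]
      split_ifs <;> simp
    refine ⟨b + c, (matSubmodule δ).add_mem hb hc, psi_add π U hb hc, ?_⟩
    rw [h, psi_add π U hb.nmat hc.nmat, hbs, hct]
    split_ifs <;> simp
  | smul r t _ ht =>
    obtain ⟨b, hb, rfl, hbt⟩ := ht
    have h : Nmat (r • b) 0 = r • Nmat b 0 := by
      ext i k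
      simp only [nmat_zero_apply, Pi.smul_apply]
      split_ifs <;> simp
    refine ⟨r • b, Submodule.smul_mem (matSubmodule δ) r hb, psi_smul π U r hb, ?_⟩
    rw [h, psi_smul π U r hb.nmat, hbt]
    split_ifs <;> simp

/-- Property `(*)` for sums of homogeneous operators. -/
theorem PropertyStar.norm_zero_part_le (h : PropertyStar δ π U) {d : ℤ → H →L[ℂ] H}
    (hd : ∀ j, d j ∈ degSubmodule π U δ j) {s : Finset ℤ} (hs : 0 ∈ s) :
    ‖d 0‖ ≤ ‖∑ j ∈ s, d j‖ := by
  choose b hb hbd hbn using fun j => exists_psi_eq_of_mem_degSubmodule π U (hd j)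
  have hmem : MatMem δ (∑ j ∈ s, b j) := sum_mem (S := matSubmodule δ) fun j _ => hb j
  have := h _ hmem
  rw [← hmem.psi_nmat, nmat_sum, psi_sum π U _ _ fun j _ => (hb j).nmat,
    psi_sum π U _ _ fun j _ => hb j] at this
  simpa [hbd, hbn, hs] using this

/-- Under property `(*)` the part of degree zero is unique. -/
theorem PropertyStar.zero_part_unique (h : PropertyStar δ π U) {d e : ℤ → H →L[ℂ] H}
    (hd : ∀ j, d j ∈ degSubmodule π U δ j) (he : ∀ j, e j ∈ degSubmodule π U δ j)
    {M N : ℕ} (hde : ∑ j ∈ Finset.Icc (-(M : ℤ)) M, d j = ∑ j ∈ Finset.Icc (-(N : ℤ)) N, e j) :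
    d 0 = e 0 := by
  have key : ∀ (f : ℤ → H →L[ℂ] H) (K L : ℕ), K ≤ L →
      ∑ j ∈ Finset.Icc (-(K : ℤ)) K, f j = ∑ j ∈ Finset.Icc (-(L : ℤ)) L,
        if j ∈ Finset.Icc (-(K : ℤ)) K then f j else 0 := fun f K L hKL => by
    rw [← Finset.sum_filter]
    congr 1
    ext j
    simp only [Finset.mem_Icc, Finset.mem_filter]
    omega
  have := h.norm_zero_part_le (s := Finset.Icc (-((max M N : ℕ) : ℤ)) (max M N : ℕ))
    (d := fun j => (if j ∈ Finset.Icc (-(M : ℤ)) M then d j else 0) -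
      if j ∈ Finset.Icc (-(N : ℤ)) N then e j else 0)
    (fun j => sub_mem (by split_ifs <;> simp [hd]) (by split_ifs <;> simp [he])) (by simp)
  rw [Finset.sum_sub_distrib, ← key d _ _ (le_max_left M N), ← key e _ _ (le_max_right M N),
    hde, sub_self, norm_zero] at this
  simpa [sub_eq_zero] using this

theorem norm_sum_sq_le {ι : Type*} (s : Finset ι) (c : ι → H →L[ℂ] H) :
    ‖∑ j ∈ s, c j‖ ^ 2 ≤ s.card * ‖∑ j ∈ s, c j * star (c j)‖ := by
  set S := ∑ j ∈ s, c j * star (c j)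
  have key : ∀ v, ‖star (∑ j ∈ s, c j) v‖ ^ 2 ≤ (s.card * ‖S‖) * ‖v‖ ^ 2 := fun v => by
    calc ‖star (∑ j ∈ s, c j) v‖ ^ 2 = ‖∑ j ∈ s, star (c j) v‖ ^ 2 := by
          rw [star_sum, _root_.sum_apply]
      _ ≤ (∑ j ∈ s, ‖star (c j) v‖) ^ 2 := by gcongr; exact norm_sum_le _ _
      _ ≤ s.card * ∑ j ∈ s, ‖star (c j) v‖ ^ 2 := sq_sum_le_card_mul_sum_sq
      _ = s.card * RCLike.re (inner ℂ v (S v)) := by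
          rw [_root_.sum_apply, inner_sum, map_sum]
          congr 1
          refine Finset.sum_congr rfl fun j _ => ?_
          rw [mul_apply_eq_comp, ← ContinuousLinearMap.adjoint_inner_left,
            ← ContinuousLinearMap.star_eq_adjoint, ← norm_sq_eq_re_inner]
      _ ≤ s.card * (‖v‖ * (‖S‖ * ‖v‖)) := by
          gcongr
          refine (RCLike.re_le_norm _).trans ((norm_inner_le_norm _ _).trans ?_)
          gcongr
          exact S.le_opNorm v
      _ = _ := by ring
  have h0 : 0 ≤ s.card * ‖S‖ := by positivity
  have := ContinuousLinearMap.opNorm_le_bound (star (∑ j ∈ s, c j)) (Real.sqrt_nonneg _)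
    fun v => by
      rw [← Real.sqrt_sq (norm_nonneg v), ← Real.sqrt_mul h0]
      exact Real.le_sqrt_of_sq_le (key v)
  rw [norm_star] at this
  exact (Real.le_sqrt (norm_nonneg _) h0).1 this

theorem IsSelfAdjoint.norm_pow_le_norm_pow {E : Type*} [CStarAlgebra E] {x : E}
    (hx : IsSelfAdjoint x) {n : ℕ} (hn : n ≠ 0) : ‖x‖ ^ n ≤ ‖x ^ n‖ := by
  have := spectrum.spectralRadius_pow_le (𝕜 := ℂ) x n hn
  rw [hx.spectralRadius_eq_nnnorm, (hx.pow n).spectralRadius_eq_nnnorm] at this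
  exact_mod_cast this

/-- Splitting of `c * star c` into homogeneous parts. -/
theorem IsCovariantRep.exists_decomposition_mul_star (h : IsCovariantRep δ π U)
    {c : ℤ → H →L[ℂ] H} (hc : ∀ j, c j ∈ degSubmodule π U δ j) (M : ℕ) :
    ∃ e : ℤ → H →L[ℂ] H, (∀ j, e j ∈ degSubmodule π U δ j) ∧
      ∑ j ∈ Finset.Icc (-((2 * M : ℕ) : ℤ)) (2 * M : ℕ), e j =
        (∑ j ∈ Finset.Icc (-(M : ℤ)) M, c j) * star (∑ j ∈ Finset.Icc (-(M : ℤ)) M, c j) ∧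
      e 0 = ∑ j ∈ Finset.Icc (-(M : ℤ)) M, c j * star (c j) := by
  refine ⟨fun j => ∑ i ∈ Finset.Icc (-(M : ℤ)) M, ∑ l ∈ Finset.Icc (-(M : ℤ)) M,
    if i - l = j then c i * star (c l) else 0, fun j => ?_, ?_, ?_⟩
  · refine sum_mem fun i _ => sum_mem fun l _ => ?_
    split_ifs with hil
    · rw [← hil, sub_eq_add_neg]
      exact h.degSubmodule_mul_le _ _
        (Submodule.mul_mem_mul (hc i) (star_mem_degSubmodule (hc l)))
    · exact zero_mem _
  · rw [star_sum, Finset.sum_mul, Finset.sum_comm]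
    refine Finset.sum_congr rfl fun i hi => ?_
    rw [Finset.mul_sum, Finset.sum_comm]
    refine Finset.sum_congr rfl fun l hl => ?_
    rw [Finset.sum_ite_eq, if_pos]
    simp only [Finset.mem_Icc] at hi hl ⊢
    omega
  · refine Finset.sum_congr rfl fun i hi => ?_
    simp only [sub_eq_zero]
    rw [Finset.sum_ite_eq, if_pos hi]

/-- For a self-adjoint `Psi π U b` supported in degrees of modulus at most `M`, the norm is
controlled by the degree zero part of the square. -/
theorem norm_sq_le_norm_nmat (h : IsCovariantRep δ π U) (hstar : PropertyStar δ π U)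
    {b : ℕ → ℕ → A} (hb : MatMem δ b) {t : H →L[ℂ] H} {M : ℕ} (ht : t ∈ degLE π U δ M)
    (hbt : Psi π U b = t * star t) :
    ‖t‖ ^ 2 ≤ (2 * M + 1) * ‖Psi π U (Nmat b 0)‖ := by
  obtain ⟨c, hc, rfl⟩ := mem_degLE.1 ht
  obtain ⟨e, he, hsum, he0⟩ := h.exists_decomposition_mul_star hc M
  obtain ⟨N, d, hd, hdsum, hd0⟩ := hb.exists_decomposition (π := π) (U := U)
  have hde := hstar.zero_part_unique hd he (hdsum.trans (hbt.trans hsum.symm))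
  refine (norm_sum_sq_le _ c).trans_eq ?_
  rw [← hd0, hde, he0, Int.card_Icc, show ((M : ℤ) + 1 - -(M : ℤ)).toNat = 2 * M + 1 by omega]
  push_cast
  rfl

end Operators

/-- Polynomially bounded factors disappear in the limit of roots. -/
theorem tendsto_rpow_of_pow_le {r D : ℝ} (hr : 0 ≤ r) (hD : 0 < D) {u : ℕ → ℝ}
    (hu : ∀ k, u k ≤ r ^ (4 * (k + 1))) (hl : ∀ k, r ^ (4 * (k + 1)) ≤ D * (k + 1) * u k) :
    Tendsto (fun k : ℕ => u k ^ ((4 * ((k : ℝ) + 1))⁻¹)) atTop (𝓝 r) := by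
  have hroot : ∀ k : ℕ, (r ^ (4 * (k + 1))) ^ ((4 * ((k : ℝ) + 1))⁻¹) = r := fun k => by
    have := Real.pow_rpow_inv_natCast hr (n := 4 * (k + 1)) (by omega)
    push_cast at this
    exact this
  have hpos : ∀ k : ℕ, 0 < D * ((k : ℝ) + 1) := fun k => by positivity
  have hu0 : ∀ k, 0 ≤ u k := fun k =>
    nonneg_of_mul_nonneg_right ((pow_nonneg hr _).trans (hl k)) (hpos k)
  have hlim : Tendsto (fun k : ℕ =>
      r * (D * ((k : ℝ) + 1)) ^ (-1 / (4 / D * (D * ((k : ℝ) + 1)) + 0))) atTop (𝓝 (r * 1)) := by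
    refine tendsto_const_nhds.mul
      ((tendsto_rpow_div_mul_add (-1) (4 / D) 0 (by positivity)).comp ?_)
    exact (tendsto_atTop_add_const_right _ _ tendsto_natCast_atTop_atTop).const_mul_atTop hD
  rw [mul_one] at hlim
  refine tendsto_of_tendsto_of_tendsto_of_le_of_le hlim tendsto_const_nhds (fun k => ?_) fun k => ?_
  · have he : -1 / (4 / D * (D * ((k : ℝ) + 1)) + 0) = -(4 * ((k : ℝ) + 1))⁻¹ := by
      field_simp
      ring
    simp only
    rw [he, Real.rpow_neg (hpos k).le, ← div_eq_mul_inv,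
      div_le_iff₀ (Real.rpow_pos_of_pos (hpos k) _), mul_comm, ← Real.mul_rpow (hpos k).le (hu0 k)]
    calc r = _ := (hroot k).symm
      _ ≤ _ := Real.rpow_le_rpow (by positivity) (hl k) (by positivity)
  · calc _ ≤ _ := Real.rpow_le_rpow (hu0 k) (hu k) (by positivity)
      _ = r := hroot k

/-- If `(π,U,H)` possesses property `(*)`, then for every
`a ∈ C*₀(π(A),U)` (given by a matrix in `M(A)`),
`‖a‖ = lim_{k→∞} ‖𝒩₀[(a a*)^{2k}]‖^{1/(4k)}`, where `𝒩₀` is computed on matrices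
via `N₀` (which is legitimate since property `(*)` makes `𝒩₀` well defined). -/
theorem norm_formula_via_N0 {A : Type*} [CStarAlgebra A] (δ : A →⋆ₙₐ[ℂ] A)
    {H : Type*} [NormedAddCommGroup H] [InnerProductSpace ℂ H] [CompleteSpace H]
    (π : A →⋆ₐ[ℂ] (H →L[ℂ] H)) (U : H →L[ℂ] H)
    (hrep : IsCovariantRep δ π U) (hstar : PropertyStar δ π U)
    (a : ℕ → ℕ → A) (ha : MatMem δ a) :
    Filter.Tendsto
      (fun k : ℕ =>
        ‖Psi π U (Nmat (mpow δ (conv δ a (mstar a)) (2 * (k + 1))) 0)‖ ^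
          ((4 * ((k : ℝ) + 1))⁻¹))
      Filter.atTop (nhds ‖Psi π U a‖) := by
  obtain ⟨N, d, hd, hdsum, -⟩ := ha.exists_decomposition (π := π) (U := U)
  set x := Psi π U a
  have hxmem : x ∈ degLE π U δ N := mem_degLE.2 ⟨d, hd, hdsum⟩
  have hconv : MatMem δ (conv δ a (mstar a)) := ha.conv ha.mstar
  have hpsi : ∀ n, Psi π U (mpow δ (conv δ a (mstar a)) n) = (x * star x) ^ n := fun n => by
    rw [hrep.psi_mpow hconv, hrep.psi_conv ha ha.mstar, psi_mstar π U ha]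
  have hsa : IsSelfAdjoint (x * star x) := .mul_star_self x
  have hnorm : ∀ n, ‖x * star x‖ ^ n = ‖x‖ ^ (2 * n) := fun n => by
    rw [CStarRing.norm_self_mul_star, ← sq, pow_mul]
  refine tendsto_rpow_of_pow_le (D := 4 * N + 1) (norm_nonneg x) (by positivity)
    (fun k => ?_) fun k => ?_
  · have hmem := hconv.mpow (2 * (k + 1))
    calc _ ≤ ‖(x * star x) ^ (2 * (k + 1))‖ := by
          rw [← hpsi, hmem.psi_nmat]
          exact hstar _ hmem
      _ ≤ ‖x * star x‖ ^ (2 * (k + 1)) := norm_pow_le' _ (by omega)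
      _ = ‖x‖ ^ (4 * (k + 1)) := by rw [hnorm, ← mul_assoc, show 2 * 2 = 4 from rfl]
  · have hdeg := hrep.pow_mem_degLE
      (hrep.degLE_mul_le _ _ (Submodule.mul_mem_mul hxmem (star_mem_degLE hxmem))) (k + 1)
    have hbt : Psi π U (mpow δ (conv δ a (mstar a)) (2 * (k + 1))) =
        (x * star x) ^ (k + 1) * star ((x * star x) ^ (k + 1)) := by
      rw [(hsa.pow (k + 1)).star_eq, ← pow_add, ← two_mul, hpsi]
    calc ‖x‖ ^ (4 * (k + 1)) = (‖x * star x‖ ^ (k + 1)) ^ 2 := by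
          rw [hnorm, ← pow_mul]
          ring_nf
      _ ≤ ‖(x * star x) ^ (k + 1)‖ ^ 2 := by
          gcongr
          exact hsa.norm_pow_le_norm_pow (Nat.succ_ne_zero k)
      _ ≤ _ := norm_sq_le_norm_nmat hrep hstar (hconv.mpow _) hdeg hbt
      _ ≤ _ := by
          gcongr
          push_cast
          nlinarith [Nat.cast_nonneg (α := ℝ) k]
end
end

section
/- Let J be a closed two-sided ideal of A with J ∩ Ker δ = {0}, and let (π₁,U₁,H₁) and (π₂,U₂,H₂) be two covariant representations of (A,δ), both associated with J and both possessing property (*). Then there exists a *-isomorphism Φ from C*(π₁(A),U₁) (the C*-subalgebra of B(H₁) generated by π₁(A) and U₁) onto C*(π₂(A),U₂) such that Φ(π₁(a)) = π₂(a) for all a ∈ A and Φ(U₁) = U₂. -/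
open Filter Topology
open scoped NNReal

noncomputable section

variable {A : Type*} [CStarAlgebra A]

variable {H : Type*} [NormedAddCommGroup H] [InnerProductSpace ℂ H] [CompleteSpace H]

/-- The algebraic relations of a covariant representation, in an arbitrary `⋆`-algebra. -/
structure IsCovariantPair {A B : Type*} [CStarAlgebra A] [Ring B] [StarRing B] [Algebra ℂ B]
    (δ : A →⋆ₙₐ[ℂ] A) (π : A →⋆ₐ[ℂ] B) (U : B) : Prop where
  partial_isometry : U * star U * U = U
  covariant : ∀ a : A, U * π a * star U = π (δ a)
  comm : ∀ a : A, star U * U * π a = π a * (star U * U)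

namespace IsCovariantPair

section Algebraic

variable {A B : Type*} [CStarAlgebra A] [Ring B] [StarRing B] [Algebra ℂ B]
  {δ : A →⋆ₙₐ[ℂ] A} {π : A →⋆ₐ[ℂ] B} {U : B}

theorem mul_map (h : IsCovariantPair δ π U) (a : A) : U * π a = π (δ a) * U := by
  calc U * π a = U * star U * U * π a := by rw [h.partial_isometry]
    _ = U * (star U * U * π a) := by simp only [mul_assoc]
    _ = U * π a * star U * U := by rw [h.comm]; simp only [mul_assoc]
    _ = π (δ a) * U := by rw [h.covariant]

theorem pow_mul_map (h : IsCovariantPair δ π U) (n : ℕ) (a : A) :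
    U ^ n * π a = π ((⇑δ)^[n] a) * U ^ n := by
  induction n with
  | zero => simp
  | succ n ih =>
    rw [pow_succ', mul_assoc, ih, ← mul_assoc, h.mul_map, mul_assoc, Function.iterate_succ_apply']

theorem iterate_star (δ : A →⋆ₙₐ[ℂ] A) (n : ℕ) (a : A) :
    (⇑δ)^[n] (star a) = star ((⇑δ)^[n] a) := by
  induction n with
  | zero => rfl
  | succ n ih => rw [Function.iterate_succ_apply', ih, map_star, Function.iterate_succ_apply']

theorem iterate_mul (δ : A →⋆ₙₐ[ℂ] A) (n : ℕ) (a b : A) :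
    (⇑δ)^[n] (a * b) = (⇑δ)^[n] a * (⇑δ)^[n] b := by
  induction n with
  | zero => rfl
  | succ n ih => simp only [Function.iterate_succ_apply', ih, map_mul]

theorem map_mul_star_pow (h : IsCovariantPair δ π U) (n : ℕ) (a : A) :
    π a * star U ^ n = star U ^ n * π ((⇑δ)^[n] a) := by
  have := congrArg star (h.pow_mul_map n (star a))
  simpa [star_mul, ← map_star, ← iterate_star] using this

theorem pow_mul_star_pow (h : IsCovariantPair δ π U) (n : ℕ) :
    U ^ n * star U ^ n = π ((⇑δ)^[n] 1) := by
  induction n with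
  | zero => simp
  | succ n ih =>
    rw [pow_succ' U, pow_succ (star U), Function.iterate_succ_apply', ← h.covariant, ← ih]
    simp only [mul_assoc]

theorem star_mul_star (h : IsCovariantPair δ π U) : star U * U * star U = star U := by
  have := congrArg star h.partial_isometry
  simpa [star_mul, mul_assoc] using this

theorem star_pow_mul_map_mul_pow (h : IsCovariantPair δ π U) (m n : ℕ) (a : A) :
    star U ^ m * π ((⇑δ)^[m] 1 * a * (⇑δ)^[n] 1) * U ^ n = star U ^ m * π a * U ^ n := by
  have e1 := h.map_mul_star_pow m 1
  have e2 := h.pow_mul_map n 1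
  rw [map_one, one_mul] at e1
  rw [map_one, mul_one] at e2
  rw [map_mul, map_mul]
  simp only [mul_assoc]
  rw [← e2, ← mul_assoc, ← e1]

end Algebraic

end IsCovariantPair

theorem norm_add_eq_max_of_orthogonal {B : Type*} [CStarAlgebra B] {s t : B}
    (h₁ : star s * t = 0) (h₂ : s * star t = 0) : ‖s + t‖ = max ‖s‖ ‖t‖ := by
  have h₃ : star t * s = 0 := by simpa using congrArg star h₁
  have key : ‖s + t‖ * ‖s + t‖ = max (‖s‖ * ‖s‖) (‖t‖ * ‖t‖) := by
    simp only [← CStarRing.norm_star_mul_self]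
    have e : star (s + t) * (s + t) = star s * s + star t * t := by
      simp [add_mul, mul_add, h₁, h₃]
    rw [e]
    refine IsSelfAdjoint.norm_add_eq_max (.star_mul_self s) (.star_mul_self t) ?_
    rw [mul_assoc, ← mul_assoc s, h₂]
    simp
  rcases le_total ‖s‖ ‖t‖ with h | h
  · rw [max_eq_right h]
    rw [max_eq_right (by gcongr)] at key
    exact (mul_self_inj (norm_nonneg _) (norm_nonneg _)).1 key
  · rw [max_eq_left h]
    rw [max_eq_left (by gcongr)] at key
    exact (mul_self_inj (norm_nonneg _) (norm_nonneg _)).1 key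

theorem norm_le_of_ker_le {A B₁ B₂ : Type*} [CStarAlgebra A] [CStarAlgebra B₁] [CStarAlgebra B₂]
    (φ₁ : A →⋆ₙₐ[ℂ] B₁) (φ₂ : A →⋆ₙₐ[ℂ] B₂) (h : ∀ a, φ₂ a = 0 → φ₁ a = 0) (a : A) :
    ‖φ₁ a‖ ≤ ‖φ₂ a‖ := by
  have key (b : A) (hb : IsSelfAdjoint b) : ‖φ₁ b‖ ≤ ‖φ₂ b‖ := by
    set r := ‖φ₂ b‖ with hr
    have hr0 : 0 ≤ r := norm_nonneg _
    let f : ℝ → ℝ := fun t => max (|t| - r) 0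
    have hf : Continuous f := by fun_prop
    have hf0 : f 0 = 0 := by simp [f, hr0]
    have hb₁ : IsSelfAdjoint (φ₁ b) := hb.map φ₁
    have hb₂ : IsSelfAdjoint (φ₂ b) := hb.map φ₂
    have hc₁ : Continuous φ₁ := AddMonoidHomClass.continuous_of_bound φ₁ 1 fun x => by
      simpa using NonUnitalStarAlgHom.norm_apply_le φ₁ x
    have hc₂ : Continuous φ₂ := AddMonoidHomClass.continuous_of_bound φ₂ 1 fun x => by
      simpa using NonUnitalStarAlgHom.norm_apply_le φ₂ x
    have m₁ := φ₁.map_cfcₙ f b hf.continuousOn hf0 hc₁ hb hb₁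
    have m₂ := φ₂.map_cfcₙ f b hf.continuousOn hf0 hc₂ hb hb₂
    have z₂ : cfcₙ f (φ₂ b) = 0 := by
      rw [← norm_le_zero_iff]
      refine norm_cfcₙ_le fun x hx => ?_
      have := norm_apply_le_norm_cfcₙ (fun t : ℝ => t) (φ₂ b) hx continuousOn_id rfl hb₂
      rw [cfcₙ_id' ℝ (φ₂ b) hb₂, Real.norm_eq_abs, ← hr] at this
      simp [f, this]
    have z₁ : cfcₙ f (φ₁ b) = 0 := by rw [← m₁]; exact h _ (by rw [m₂, z₂])
    have := (norm_cfcₙ_le_iff (fun t : ℝ => t) (φ₁ b) r continuousOn_id rfl hb₁).2 fun x hx => by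
      have h1 := norm_apply_le_norm_cfcₙ f (φ₁ b) hx hf.continuousOn hf0 hb₁
      rw [z₁, norm_zero, norm_le_zero_iff] at h1
      simpa [f] using h1
    rwa [cfcₙ_id' ℝ (φ₁ b) hb₁] at this
  have := key (star a * a) (.star_mul_self a)
  rw [map_mul, map_mul, map_star, map_star, CStarRing.norm_star_mul_self,
    CStarRing.norm_star_mul_self] at this
  exact abs_le_of_sq_le_sq' (by nlinarith) (norm_nonneg _) |>.2

theorem norm_eq_of_ker_eq {A B₁ B₂ : Type*} [CStarAlgebra A] [CStarAlgebra B₁] [CStarAlgebra B₂]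
    (φ₁ : A →⋆ₙₐ[ℂ] B₁) (φ₂ : A →⋆ₙₐ[ℂ] B₂) (h : ∀ a, φ₁ a = 0 ↔ φ₂ a = 0) (a : A) :
    ‖φ₁ a‖ = ‖φ₂ a‖ :=
  le_antisymm (norm_le_of_ker_le φ₁ φ₂ (fun a => (h a).2) a)
    (norm_le_of_ker_le φ₂ φ₁ (fun a => (h a).1) a)

namespace IsCovariantPair

section Diagonal

variable {A B : Type*} [CStarAlgebra A] [CStarAlgebra B]
  {δ : A →⋆ₙₐ[ℂ] A} {π : A →⋆ₐ[ℂ] B} {U : B}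

/-- The compression of `π` to the complement of the initial projection of `U`. -/
def defectHom (h : IsCovariantPair δ π U) : A →⋆ₙₐ[ℂ] B where
  toFun a := π a * (1 - star U * U)
  map_smul' z a := by simp
  map_zero' := by simp
  map_add' a b := by simp [add_mul]
  map_mul' a b := by
    have e : (1 - star U * U) * π b = π b * (1 - star U * U) := by
      rw [sub_mul, mul_sub, h.comm, one_mul, mul_one]
    have p : (1 - star U * U) * (1 - star U * U) = 1 - star U * U := by
      have : star U * U * (star U * U) = star U * U := by rw [← mul_assoc, h.star_mul_star]
      rw [mul_sub, mul_one, sub_mul, this]; simp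
    calc π (a * b) * (1 - star U * U) = π a * (π b * (1 - star U * U)) := by
          rw [map_mul, mul_assoc]
      _ = π a * (π b * (1 - star U * U) * (1 - star U * U)) := by rw [mul_assoc (π b), p]
      _ = π a * ((1 - star U * U) * π b) * (1 - star U * U) := by rw [e]; simp only [mul_assoc]
      _ = _ := by simp only [mul_assoc]
  map_star' a := by
    have e : (1 - star U * U) * π (star a) = π (star a) * (1 - star U * U) := by
      rw [sub_mul, mul_sub, h.comm, one_mul, mul_one]
    rw [← e]
    simp [map_star]

theorem defectHom_eq_zero_iff (h : IsCovariantPair δ π U) (a : A) :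
    h.defectHom a = 0 ↔ star U * U * π a = π a := by
  change π a * (1 - star U * U) = 0 ↔ _
  rw [mul_sub, mul_one, sub_eq_zero, h.comm, eq_comm]

theorem norm_le_one (h : IsCovariantPair δ π U) : ‖U‖ ≤ 1 := by
  have h1 : ‖U * star U‖ ≤ 1 := by
    rw [show U * star U = π (δ 1) by rw [← h.covariant, map_one, mul_one]]
    have hp : π (δ 1) * π (δ 1) = π (δ 1) := by rw [← map_mul, ← map_mul, one_mul]
    have hs : star (π (δ 1)) = π (δ 1) := by rw [← map_star, ← map_star, star_one]
    have := CStarRing.norm_star_mul_self (x := π (δ 1))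
    rw [hs, hp] at this
    nlinarith [norm_nonneg (π (δ 1))]
  rw [CStarRing.norm_self_mul_star] at h1
  nlinarith [norm_nonneg U]

theorem norm_star_mul_mul (h : IsCovariantPair δ π U) (z : B) :
    ‖star U * z * U‖ = ‖π (δ 1) * z * π (δ 1)‖ := by
  have hU := h.norm_le_one
  have hU' : ‖star U‖ ≤ 1 := by rwa [norm_star]
  have e : π (δ 1) = U * star U := by rw [← h.covariant, map_one, mul_one]
  have bound (x y w : B) (hx : ‖x‖ ≤ 1) (hw : ‖w‖ ≤ 1) : ‖x * y * w‖ ≤ ‖y‖ := by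
    calc ‖x * y * w‖ ≤ ‖x‖ * ‖y‖ * ‖w‖ := (norm_mul_le _ _).trans (by gcongr; exact norm_mul_le _ _)
      _ ≤ 1 * ‖y‖ * 1 := by gcongr
      _ = ‖y‖ := by ring
  rw [e]
  apply le_antisymm
  · have := bound (star U) (U * star U * z * (U * star U)) U hU' hU
    have e' : star U * z * U = star U * (U * star U * z * (U * star U)) * U := by
      calc star U * z * U = star U * U * star U * z * (U * star U * U) := by
            rw [h.star_mul_star, h.partial_isometry]
        _ = _ := by simp only [mul_assoc]
    rwa [e']
  · have := bound U (star U * z * U) (star U) hU hU'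
    simpa only [mul_assoc] using this

/-- One step of the reduction computing the norm of a diagonal element. -/
theorem norm_sum_diag_succ (h : IsCovariantPair δ π U) (N : ℕ) (a : ℕ → A) :
    ‖∑ m ∈ Finset.range (N + 2), star U ^ m * π (a m) * U ^ m‖ =
      max ‖h.defectHom (a 0)‖ ‖∑ m ∈ Finset.range (N + 1), star U ^ m *
        π ((if m = 0 then δ (a 0) else 0) +
          (⇑δ)^[m + 1] 1 * a (m + 1) * (⇑δ)^[m + 1] 1) * U ^ m‖ := by
  set y := ∑ m ∈ Finset.range (N + 1), star U ^ m * π (a (m + 1)) * U ^ m with hy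
  have hs : ∑ m ∈ Finset.range (N + 2), star U ^ m * π (a m) * U ^ m =
      h.defectHom (a 0) + star U * (π (δ (a 0)) + y) * U := by
    rw [Finset.sum_range_succ']
    have e1 : star U * y * U =
        ∑ m ∈ Finset.range (N + 1), star U ^ (m + 1) * π (a (m + 1)) * U ^ (m + 1) := by
      rw [hy, Finset.mul_sum, Finset.sum_mul]
      refine Finset.sum_congr rfl fun m _ => ?_
      rw [pow_succ' (star U), pow_succ U]
      simp only [mul_assoc]
    have e2 : star U * π (δ (a 0)) * U = π (a 0) * (star U * U) := by
      rw [mul_assoc, ← h.mul_map, ← mul_assoc, h.comm]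
    have e3 : h.defectHom (a 0) = π (a 0) * (1 - star U * U) := rfl
    rw [mul_add, add_mul, e1, e2, e3, mul_sub]
    simp only [pow_zero, one_mul, mul_one]
    abel
  have z1 : (1 - star U * U) * star U = 0 := by rw [sub_mul, one_mul, h.star_mul_star, sub_self]
  have o (b : A) (w : B) : h.defectHom b * (star U * w * U) = 0 := by
    change π b * (1 - star U * U) * _ = 0
    calc _ = π b * ((1 - star U * U) * star U) * w * U := by simp only [mul_assoc]
      _ = 0 := by rw [z1]; simp
  rw [hs, norm_add_eq_max_of_orthogonal (by rw [← map_star]; exact o _ _)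
    (by simpa [mul_assoc] using o (a 0) (star (π (δ (a 0)) + y))), h.norm_star_mul_mul]
  congr 2
  rw [mul_add, add_mul]
  simp only [map_add, mul_add, add_mul, Finset.sum_add_distrib]
  congr 1
  · rw [Finset.sum_eq_single 0]
    · simp [← map_mul]
    · intro m _ hm
      simp [hm]
    · simp
  · rw [hy, Finset.mul_sum, Finset.sum_mul]
    refine Finset.sum_congr rfl fun m _ => ?_
    rw [Function.iterate_succ_apply, map_mul, map_mul]
    calc _ = (π (δ 1) * star U ^ m) * π (a (m + 1)) * (U ^ m * π (δ 1)) := by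
          simp only [mul_assoc]
      _ = _ := by rw [h.map_mul_star_pow, h.pow_mul_map]; simp only [mul_assoc]

theorem norm_sum_diag_eq {B₂ : Type*} [CStarAlgebra B₂] {π₂ : A →⋆ₐ[ℂ] B₂} {U₂ : B₂}
    (h : IsCovariantPair δ π U) (h₂ : IsCovariantPair δ π₂ U₂)
    (hinj : Function.Injective π) (hinj₂ : Function.Injective π₂)
    (hker : ∀ a, star U * U * π a = π a ↔ star U₂ * U₂ * π₂ a = π₂ a) (N : ℕ) (a : ℕ → A) :
    ‖∑ m ∈ Finset.range (N + 1), star U ^ m * π (a m) * U ^ m‖ =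
      ‖∑ m ∈ Finset.range (N + 1), star U₂ ^ m * π₂ (a m) * U₂ ^ m‖ := by
  induction N generalizing a with
  | zero =>
    simpa using norm_eq_of_ker_eq (π : A →⋆ₙₐ[ℂ] B) (π₂ : A →⋆ₙₐ[ℂ] B₂)
      (fun a => by
        change π a = 0 ↔ π₂ a = 0
        rw [map_eq_zero_iff π hinj, map_eq_zero_iff π₂ hinj₂]) (a 0)
  | succ N ih =>
    rw [h.norm_sum_diag_succ, h₂.norm_sum_diag_succ, ih,
      norm_eq_of_ker_eq h.defectHom h₂.defectHom fun a => by
        rw [h.defectHom_eq_zero_iff, h₂.defectHom_eq_zero_iff, hker]]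

end Diagonal

end IsCovariantPair

section Graded

variable {A B : Type*} [CStarAlgebra A] [Ring B] [StarRing B] [Algebra ℂ B]

/-- The additive span of the elements `U^{*m} π(a) U^n` with degree `n - m` in `K`. -/
def gradedPart (π : A →⋆ₐ[ℂ] B) (U : B) (K : Set ℤ) : AddSubmonoid B :=
  AddSubmonoid.closure
    {x | ∃ (m n : ℕ) (a : A), (n : ℤ) - m ∈ K ∧ star U ^ m * π a * U ^ n = x}

variable {δ : A →⋆ₙₐ[ℂ] A} {π : A →⋆ₐ[ℂ] B} {U : B}

theorem mem_gradedPart {K : Set ℤ} {m n : ℕ} (a : A) (h : (n : ℤ) - m ∈ K) :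
    star U ^ m * π a * U ^ n ∈ gradedPart π U K :=
  AddSubmonoid.subset_closure ⟨m, n, a, h, rfl⟩

theorem gradedPart_mono {K L : Set ℤ} (h : K ⊆ L) : gradedPart π U K ≤ gradedPart π U L :=
  AddSubmonoid.closure_mono fun _ ⟨m, n, a, hk, hx⟩ => ⟨m, n, a, h hk, hx⟩

open scoped Pointwise in
theorem IsCovariantPair.mul_mem_gradedPart (h : IsCovariantPair δ π U) {K L : Set ℤ} {x y : B}
    (hx : x ∈ gradedPart π U K) (hy : y ∈ gradedPart π U L) : x * y ∈ gradedPart π U (K + L) := by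
  have := AddSubmonoid.mul_mem_mul hx hy
  rw [gradedPart, gradedPart, AddSubmonoid.closure_mul_closure] at this
  refine AddSubmonoid.closure_mono ?_ this
  rintro _ ⟨_, ⟨m, n, a, hk, rfl⟩, _, ⟨k, l, b, hl, rfl⟩, rfl⟩
  rcases le_total n k with hnk | hnk
  · obtain ⟨d, rfl⟩ := Nat.exists_eq_add_of_le hnk
    refine ⟨m + d, l, (⇑δ)^[d] (a * (⇑δ)^[n] 1) * b, ⟨_, hk, _, hl, ?_⟩, ?_⟩
    · push_cast
      ring
    · symm
      calc star U ^ m * π a * U ^ n * (star U ^ (n + d) * π b * U ^ l)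
          = star U ^ m * (π a * (U ^ n * star U ^ n)) * star U ^ d * π b * U ^ l := by
            rw [pow_add]; simp only [mul_assoc]
        _ = star U ^ m * (π (a * (⇑δ)^[n] 1) * star U ^ d) * π b * U ^ l := by
            rw [h.pow_mul_star_pow, map_mul]; simp only [mul_assoc]
        _ = _ := by rw [h.map_mul_star_pow, pow_add, map_mul]; simp only [mul_assoc]
  · obtain ⟨d, rfl⟩ := Nat.exists_eq_add_of_le hnk
    refine ⟨m, d + l, a * (⇑δ)^[d] ((⇑δ)^[k] 1 * b), ⟨_, hk, _, hl, ?_⟩, ?_⟩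
    · push_cast
      ring
    · symm
      calc star U ^ m * π a * U ^ (k + d) * (star U ^ k * π b * U ^ l)
          = star U ^ m * π a * U ^ d * ((U ^ k * star U ^ k) * π b) * U ^ l := by
            rw [add_comm k, pow_add]; simp only [mul_assoc]
        _ = star U ^ m * π a * (U ^ d * π ((⇑δ)^[k] 1 * b)) * U ^ l := by
            rw [h.pow_mul_star_pow, map_mul]; simp only [mul_assoc]
        _ = _ := by rw [h.pow_mul_map, pow_add, map_mul]; simp only [mul_assoc]

open scoped Pointwise in
theorem star_mem_gradedPart {K : Set ℤ} {x : B} (hx : x ∈ gradedPart π U K) :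
    star x ∈ gradedPart π U (-K) := by
  induction hx using AddSubmonoid.closure_induction with
  | mem x hx =>
    obtain ⟨m, n, a, hk, rfl⟩ := hx
    have := mem_gradedPart (π := π) (U := U) (K := -K) (m := n) (n := m) (star a)
      (by simpa using hk)
    simpa [star_mul, mul_assoc, map_star] using this
  | zero => simp
  | add x y _ _ hx hy => simpa using add_mem hx hy

section Prod

variable {B' : Type*} [Ring B'] [StarRing B'] [Algebra ℂ B'] {π' : A →⋆ₐ[ℂ] B'} {U' : B'}
  {K : Set ℤ} {x : B × B'}

theorem snd_mem_gradedPart (hx : x ∈ gradedPart (π.prod π') (U, U') K) :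
    x.2 ∈ gradedPart π' U' K := by
  induction hx using AddSubmonoid.closure_induction with
  | mem x hx =>
    obtain ⟨m, n, a, hk, rfl⟩ := hx
    exact mem_gradedPart a hk
  | zero => exact zero_mem _
  | add x y _ _ hx hy => exact add_mem hx hy

theorem swap_mem_gradedPart (hx : x ∈ gradedPart (π.prod π') (U, U') K) :
    x.swap ∈ gradedPart (π'.prod π) (U', U) K := by
  induction hx using AddSubmonoid.closure_induction with
  | mem x hx =>
    obtain ⟨m, n, a, hk, rfl⟩ := hx
    exact mem_gradedPart (π := π'.prod π) (U := (U', U)) a hk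
  | zero => exact zero_mem _
  | add x y _ _ hx hy => exact add_mem hx hy

end Prod

theorem exists_sum_of_mem_gradedPart {s : Finset ℤ} {x : B} (hx : x ∈ gradedPart π U s) :
    ∃ c : ℤ → B, (∀ k, c k ∈ gradedPart π U {k}) ∧ x = ∑ k ∈ s, c k := by
  induction hx using AddSubmonoid.closure_induction with
  | mem x hx =>
    obtain ⟨m, n, a, hk, rfl⟩ := hx
    refine ⟨fun k => if k = (n : ℤ) - m then star U ^ m * π a * U ^ n else 0, fun k => ?_, ?_⟩
    · dsimp only
      split_ifs with h
      · exact mem_gradedPart a h.symm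
      · exact zero_mem _
    · rw [Finset.sum_ite_eq', if_pos (Finset.mem_coe.1 hk)]
  | zero => exact ⟨0, fun k => zero_mem _, by simp⟩
  | add x y _ _ hx hy =>
    obtain ⟨c, hc, rfl⟩ := hx
    obtain ⟨d, hd, rfl⟩ := hy
    exact ⟨c + d, fun k => add_mem (hc k) (hd k), by simp [Finset.sum_add_distrib]⟩

theorem exists_mem_gradedPart_Icc {x : B} (hx : x ∈ gradedPart π U Set.univ) :
    ∃ N : ℕ, x ∈ gradedPart π U (Set.Icc (-N : ℤ) N) := by
  induction hx using AddSubmonoid.closure_induction with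
  | mem x hx =>
    obtain ⟨m, n, a, -, rfl⟩ := hx
    exact ⟨m + n, mem_gradedPart a (by constructor <;> push_cast <;> omega)⟩
  | zero => exact ⟨0, zero_mem _⟩
  | add x y _ _ hx hy =>
    obtain ⟨N, hN⟩ := hx
    obtain ⟨M, hM⟩ := hy
    refine ⟨N + M, add_mem (gradedPart_mono ?_ hN) (gradedPart_mono ?_ hM)⟩ <;>
      exact Set.Icc_subset_Icc (by push_cast; omega) (by push_cast; omega)

theorem exists_diag_sum_of_mem_gradedPart {x : B} (hx : x ∈ gradedPart π U {0}) :
    ∃ (N : ℕ) (a : ℕ → A), x = ∑ m ∈ Finset.range (N + 1), star U ^ m * π (a m) * U ^ m := by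
  let F : (ℕ →₀ A) →+ B := Finsupp.liftAddHom fun m =>
    (AddMonoidHom.mulRight (U ^ m)).comp ((AddMonoidHom.mulLeft (star U ^ m)).comp
      (π : A →+ B))
  have hF : gradedPart π U {0} ≤ AddMonoidHom.mrange F := by
    refine (AddSubmonoid.closure_le).2 ?_
    rintro _ ⟨m, n, a, hk, rfl⟩
    obtain rfl : n = m := by simpa [sub_eq_zero] using hk
    exact ⟨Finsupp.single n a, by simp [F]⟩
  obtain ⟨a, rfl⟩ := hF hx
  refine ⟨a.support.sup id, a, ?_⟩
  change a.sum _ = _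
  rw [Finsupp.sum_of_support_subset _ (s := Finset.range (a.support.sup id + 1))]
  · rfl
  · intro m hm
    exact Finset.mem_range.2 (Nat.lt_succ_of_le (Finset.le_sup (f := id) hm))
  · intro m _
    simp

open scoped Pointwise in
theorem IsCovariantPair.mul_star_mem_gradedPart (h : IsCovariantPair δ π U) {j k : ℤ} {x y : B}
    (hx : x ∈ gradedPart π U {j}) (hy : y ∈ gradedPart π U {k}) :
    x * star y ∈ gradedPart π U {j - k} := by
  have := h.mul_mem_gradedPart hx (star_mem_gradedPart hy)
  rwa [← Set.image_neg_eq_neg, Set.image_singleton, Set.singleton_add_singleton,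
    ← sub_eq_add_neg] at this

theorem IsCovariantPair.mul_mem_gradedPart_Icc (h : IsCovariantPair δ π U) {M N : ℕ} {x y : B}
    (hx : x ∈ gradedPart π U (Set.Icc (-M : ℤ) M)) (hy : y ∈ gradedPart π U (Set.Icc (-N : ℤ) N)) :
    x * y ∈ gradedPart π U (Set.Icc (-(M + N : ℕ) : ℤ) (M + N : ℕ)) := by
  refine gradedPart_mono ?_ (h.mul_mem_gradedPart hx hy)
  rintro _ ⟨j, hj, k, hk, rfl⟩
  simp only [Set.mem_Icc] at *
  push_cast
  omega

theorem star_mem_gradedPart_Icc {N : ℕ} {x : B}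
    (hx : x ∈ gradedPart π U (Set.Icc (-N : ℤ) N)) :
    star x ∈ gradedPart π U (Set.Icc (-N : ℤ) N) := by
  simpa using star_mem_gradedPart hx

theorem IsCovariantPair.pow_mem_gradedPart_Icc (h : IsCovariantPair δ π U) {N : ℕ} {x : B}
    (hx : x ∈ gradedPart π U (Set.Icc (-N : ℤ) N)) (n : ℕ) :
    x ^ n ∈ gradedPart π U (Set.Icc (-(N * n : ℕ) : ℤ) (N * n : ℕ)) := by
  induction n with
  | zero => simpa using mem_gradedPart (π := π) (U := U) (K := {0}) (m := 0) (n := 0) 1 (by simp)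
  | succ n ih =>
    rw [pow_succ, Nat.mul_succ]
    exact h.mul_mem_gradedPart_Icc ih hx

theorem IsCovariantPair.adjoin_le_gradedPart [StarModule ℂ B] (h : IsCovariantPair δ π U) {x : B}
    (hx : x ∈ StarAlgebra.adjoin ℂ (Set.range ⇑π ∪ {U})) : x ∈ gradedPart π U Set.univ := by
  have hπ (a : A) : π a ∈ gradedPart π U Set.univ := by
    simpa using mem_gradedPart (π := π) (U := U) (m := 0) (n := 0) a (Set.mem_univ _)
  induction hx using StarAlgebra.adjoin_induction with
  | mem x hx =>
    rcases hx with ⟨a, rfl⟩ | rfl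
    · exact hπ a
    · simpa using mem_gradedPart (π := π) (U := x) (m := 0) (n := 1) 1 (Set.mem_univ _)
  | algebraMap r => exact AlgHomClass.commutes π r ▸ hπ (algebraMap ℂ A r)
  | add x y _ _ hx hy => exact add_mem hx hy
  | mul x y _ _ hx hy => exact gradedPart_mono (Set.subset_univ _) (h.mul_mem_gradedPart hx hy)
  | star x _ hx => exact gradedPart_mono (Set.subset_univ _) (star_mem_gradedPart hx)

end Graded

section Expectation

variable {A H : Type*} [CStarAlgebra A] [NormedAddCommGroup H] [InnerProductSpace ℂ H]
  [CompleteSpace H] {δ : A →⋆ₙₐ[ℂ] A} {π : A →⋆ₐ[ℂ] (H →L[ℂ] H)} {U : H →L[ℂ] H}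

/-- `x` is represented by a matrix in `M(A)` whose diagonal represents `x₀`. -/
def HasDiagonal (δ : A →⋆ₙₐ[ℂ] A) (π : A →⋆ₐ[ℂ] (H →L[ℂ] H)) (U x x₀ : H →L[ℂ] H) : Prop :=
  ∃ a : ℕ → ℕ → A, MatMem δ a ∧ Psi π U a = x ∧ ∑ᶠ m : ℕ, (star U) ^ m * π (a m m) * U ^ m = x₀

theorem HasDiagonal.zero : HasDiagonal δ π U 0 0 :=
  ⟨0, ⟨by simp, by simp⟩, by simp [Psi], by simp⟩

theorem HasDiagonal.add {x y x₀ y₀ : H →L[ℂ] H} (hx : HasDiagonal δ π U x x₀)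
    (hy : HasDiagonal δ π U y y₀) : HasDiagonal δ π U (x + y) (x₀ + y₀) := by
  obtain ⟨a, ⟨ha, ha'⟩, rfl, rfl⟩ := hx
  obtain ⟨b, ⟨hb, hb'⟩, rfl, rfl⟩ := hy
  have row (c : ℕ → ℕ → A) (hc : ({p : ℕ × ℕ | c p.1 p.2 ≠ 0}).Finite) (m : ℕ) :
      (Function.support fun n => (star U) ^ m * π (c m n) * U ^ n).Finite := by
    refine (hc.image Prod.snd).subset fun n hn => ⟨(m, n), fun h => hn ?_, rfl⟩
    simp [show c m n = 0 from h]
  have col (c : ℕ → ℕ → A) (hc : ({p : ℕ × ℕ | c p.1 p.2 ≠ 0}).Finite) :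
      (Function.support fun m => ∑ᶠ n : ℕ, (star U) ^ m * π (c m n) * U ^ n).Finite := by
    refine (hc.image Prod.fst).subset fun m hm => ?_
    by_contra hne
    refine hm (finsum_eq_zero_of_forall_eq_zero fun n => ?_)
    have : c m n = 0 := by
      by_contra h0
      exact hne ⟨(m, n), h0, rfl⟩
    simp [this]
  have diag (c : ℕ → ℕ → A) (hc : ({p : ℕ × ℕ | c p.1 p.2 ≠ 0}).Finite) :
      (Function.support fun m => (star U) ^ m * π (c m m) * U ^ m).Finite := by
    refine (hc.image Prod.fst).subset fun m hm => ⟨(m, m), fun h => hm ?_, rfl⟩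
    simp [show c m m = 0 from h]
  refine ⟨a + b, ⟨(ha.union hb).subset fun p hp => ?_, fun i j => ?_⟩, ?_, ?_⟩
  · by_contra h
    simp only [Set.mem_union, Set.mem_ofPred_eq, not_or, not_not] at h
    exact hp (by simp [h.1, h.2])
  · simp [mul_add, add_mul, ha', hb']
  · rw [Psi, Psi, Psi, ← finsum_add_distrib (col a ha) (col b hb)]
    refine finsum_congr fun m => ?_
    rw [← finsum_add_distrib (row a ha m) (row b hb m)]
    simp [mul_add, add_mul]
  · rw [← finsum_add_distrib (diag a ha) (diag b hb)]
    simp [mul_add, add_mul]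

theorem IsCovariantPair.hasDiagonal_star_pow_mul (h : IsCovariantPair δ π U) (m n : ℕ) (b : A) :
    HasDiagonal δ π U (star U ^ m * π b * U ^ n)
      (if (n : ℤ) - m = 0 then star U ^ m * π b * U ^ n else 0) := by
  have idem (i : ℕ) : (⇑δ)^[i] 1 * (⇑δ)^[i] 1 = (⇑δ)^[i] 1 := by
    rw [← iterate_mul, one_mul]
  set c := (⇑δ)^[m] 1 * b * (⇑δ)^[n] 1 with hc
  refine ⟨fun i j => if i = m ∧ j = n then c else 0, ⟨?_, fun i j => ?_⟩, ?_, ?_⟩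
  · refine (Set.finite_singleton (m, n)).subset fun p hp => ?_
    by_contra hne
    refine hp (if_neg fun h => hne ?_)
    exact Prod.ext h.1 h.2
  · dsimp only
    split_ifs with hij
    · obtain ⟨rfl, rfl⟩ := hij
      calc _ = ((⇑δ)^[i] 1 * (⇑δ)^[i] 1) * b * ((⇑δ)^[j] 1 * (⇑δ)^[j] 1) := by
            rw [hc]; simp only [mul_assoc]
        _ = c := by rw [idem, idem]
    · simp
  · rw [Psi, finsum_eq_single _ m, finsum_eq_single _ n]
    · simpa [hc] using h.star_pow_mul_map_mul_pow m n b
    · intro j hj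
      simp [hj]
    · intro i hi
      simp [hi]
  · rw [finsum_eq_single _ m]
    · by_cases hmn : m = n
      · subst hmn
        simpa [hc] using h.star_pow_mul_map_mul_pow m m b
      · have : ¬ ((n : ℤ) - m = 0) := by omega
        simp [hmn, this]
    · intro i hi
      simp [hi]

theorem IsCovariantPair.hasDiagonal_of_mem_gradedPart (h : IsCovariantPair δ π U) {k : ℤ}
    {x : H →L[ℂ] H} (hx : x ∈ gradedPart π U {k}) :
    HasDiagonal δ π U x (if k = 0 then x else 0) := by
  induction hx using AddSubmonoid.closure_induction with
  | mem x hx =>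
    obtain ⟨m, n, a, rfl, rfl⟩ := hx
    exact h.hasDiagonal_star_pow_mul m n a
  | zero => simpa using HasDiagonal.zero
  | add x y _ _ hx hy =>
    convert hx.add hy using 1
    split_ifs <;> simp

theorem IsCovariantPair.norm_sum_degree_zero_le (h : IsCovariantPair δ π U)
    (hstar : PropertyStar δ π U) {ι : Type*} (s : Finset ι) (d : ι → ℤ) (c : ι → H →L[ℂ] H)
    (hc : ∀ i, c i ∈ gradedPart π U {d i}) :
    ‖∑ i ∈ s, if d i = 0 then c i else 0‖ ≤ ‖∑ i ∈ s, c i‖ := by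
  have key : HasDiagonal δ π U (∑ i ∈ s, c i) (∑ i ∈ s, if d i = 0 then c i else 0) := by
    classical
    induction s using Finset.induction_on with
    | empty => simpa using HasDiagonal.zero
    | insert i s hi ih =>
      rw [Finset.sum_insert hi, Finset.sum_insert hi]
      exact (h.hasDiagonal_of_mem_gradedPart (hc i)).add ih
  obtain ⟨a, ha, hx, hx₀⟩ := key
  rw [← hx, ← hx₀]
  exact hstar a ha

theorem IsCovariantPair.norm_homogeneous_le (h : IsCovariantPair δ π U)
    (hstar : PropertyStar δ π U) (s : Finset ℤ) (c : ℤ → H →L[ℂ] H)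
    (hc : ∀ k, c k ∈ gradedPart π U {k}) {k : ℤ} (hk : k ∈ s) :
    ‖c k‖ ≤ ‖∑ j ∈ s, c j‖ := by
  have h₁ : ‖c k * star (c k)‖ ≤ ‖∑ j ∈ s, c j * star (c j)‖ :=
    CStarAlgebra.norm_le_norm_of_nonneg_of_le (mul_star_self_nonneg _)
      (Finset.single_le_sum (f := fun j => c j * star (c j))
        (fun j _ => mul_star_self_nonneg _) hk)
  have h₂ := h.norm_sum_degree_zero_le hstar (s ×ˢ s) (fun p => p.1 - p.2)
    (fun p => c p.1 * star (c p.2)) fun p => h.mul_star_mem_gradedPart (hc p.1) (hc p.2)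
  have e₁ : ∑ p ∈ s ×ˢ s, (if p.1 - p.2 = 0 then c p.1 * star (c p.2) else 0) =
      ∑ j ∈ s, c j * star (c j) := by
    rw [Finset.sum_product]
    refine Finset.sum_congr rfl fun j hj => ?_
    simp [sub_eq_zero, hj]
  have e₂ : ∑ p ∈ s ×ˢ s, c p.1 * star (c p.2) = (∑ j ∈ s, c j) * star (∑ j ∈ s, c j) := by
    rw [star_sum, Finset.sum_mul_sum, Finset.sum_product]
  rw [e₁, e₂] at h₂
  have h₃ := h₁.trans h₂
  rw [CStarRing.norm_self_mul_star, CStarRing.norm_self_mul_star] at h₃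
  exact abs_le_of_sq_le_sq' (by nlinarith) (norm_nonneg _) |>.2

end Expectation

theorem le_of_pow_two_pow_le {x y c : ℝ} (hy : 0 ≤ y)
    (h : ∀ n : ℕ, x ^ 2 ^ n ≤ (c * 2 ^ n + 1) * y ^ 2 ^ n) : x ≤ y := by
  by_contra! hlt
  have hx0 : 0 < x := hy.trans_lt hlt
  rcases hy.eq_or_lt with rfl | hy0
  · have := h 0
    simp at this
    linarith
  have hr : 1 < x / y := (one_lt_div hy0).2 hlt
  have t2 : Tendsto (fun n : ℕ => 2 ^ n) atTop atTop := tendsto_pow_atTop_atTop_of_one_lt one_lt_two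
  have t : Tendsto (fun m : ℕ => c * ((m : ℝ) ^ 1 / (x / y) ^ m) + (m : ℝ) ^ 0 / (x / y) ^ m) atTop
      (𝓝 (c * 0 + 0)) :=
    ((tendsto_pow_const_div_const_pow_of_one_lt 1 hr).const_mul c).add
      (tendsto_pow_const_div_const_pow_of_one_lt 0 hr)
  have ev := ((t.comp t2).eventually (gt_mem_nhds (show c * 0 + 0 < (1 : ℝ) by simp))).exists
  obtain ⟨n, hn⟩ := ev
  have hp : 0 < (x / y) ^ 2 ^ n := by positivity
  have hn' : c * 2 ^ n + 1 < (x / y) ^ 2 ^ n := by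
    have : c * ((2 : ℝ) ^ n / (x / y) ^ 2 ^ n) + 1 / (x / y) ^ 2 ^ n < 1 := by simpa using hn
    rw [← mul_div_assoc, ← add_div, div_lt_one hp] at this
    exact this
  rw [div_pow, lt_div_iff₀ (by positivity)] at hn'
  exact (h n).not_gt hn'

section Comparison

variable {A H₁ H₂ : Type*} [CStarAlgebra A]
  [NormedAddCommGroup H₁] [InnerProductSpace ℂ H₁] [CompleteSpace H₁]
  [NormedAddCommGroup H₂] [InnerProductSpace ℂ H₂] [CompleteSpace H₂]
  {δ : A →⋆ₙₐ[ℂ] A} {π₁ : A →⋆ₐ[ℂ] (H₁ →L[ℂ] H₁)} {U₁ : H₁ →L[ℂ] H₁}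
  {π₂ : A →⋆ₐ[ℂ] (H₂ →L[ℂ] H₂)} {U₂ : H₂ →L[ℂ] H₂}

theorem IsCovariantRep.isCovariantPair (h : IsCovariantRep δ π₁ U₁) : IsCovariantPair δ π₁ U₁ :=
  ⟨h.2.1, h.2.2.1, h.2.2.2⟩

theorem IsCovariantPair.prod (h₁ : IsCovariantPair δ π₁ U₁) (h₂ : IsCovariantPair δ π₂ U₂) :
    IsCovariantPair δ (π₁.prod π₂) (U₁, U₂) where
  partial_isometry := Prod.ext h₁.partial_isometry h₂.partial_isometry
  covariant a := Prod.ext (h₁.covariant a) (h₂.covariant a)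
  comm a := Prod.ext (h₁.comm a) (h₂.comm a)

theorem norm_fst_eq_norm_snd_of_homogeneous (h₁ : IsCovariantRep δ π₁ U₁)
    (h₂ : IsCovariantRep δ π₂ U₂)
    (hker : ∀ a, star U₁ * U₁ * π₁ a = π₁ a ↔ star U₂ * U₂ * π₂ a = π₂ a) {k : ℤ}
    {x : (H₁ →L[ℂ] H₁) × (H₂ →L[ℂ] H₂)} (hx : x ∈ gradedPart (π₁.prod π₂) (U₁, U₂) {k}) :
    ‖x.1‖ = ‖x.2‖ := by
  have hp := h₁.isCovariantPair.prod h₂.isCovariantPair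
  have hxx := hp.mul_star_mem_gradedPart hx hx
  rw [sub_self] at hxx
  obtain ⟨N, a, e⟩ := exists_diag_sum_of_mem_gradedPart hxx
  have e₁ : x.1 * star x.1 = ∑ m ∈ Finset.range (N + 1), star U₁ ^ m * π₁ (a m) * U₁ ^ m := by
    simpa [Prod.fst_sum] using congrArg Prod.fst e
  have e₂ : x.2 * star x.2 = ∑ m ∈ Finset.range (N + 1), star U₂ ^ m * π₂ (a m) * U₂ ^ m := by
    simpa [Prod.snd_sum] using congrArg Prod.snd e
  have := h₁.isCovariantPair.norm_sum_diag_eq h₂.isCovariantPair h₁.1 h₂.1 hker N a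
  rw [← e₁, ← e₂, CStarRing.norm_self_mul_star, CStarRing.norm_self_mul_star] at this
  exact (mul_self_inj (norm_nonneg _) (norm_nonneg _)).1 this

theorem norm_fst_le_mul_norm_snd (h₁ : IsCovariantRep δ π₁ U₁) (h₂ : IsCovariantRep δ π₂ U₂)
    (hstar : PropertyStar δ π₂ U₂)
    (hker : ∀ a, star U₁ * U₁ * π₁ a = π₁ a ↔ star U₂ * U₂ * π₂ a = π₂ a) {N : ℕ}
    {x : (H₁ →L[ℂ] H₁) × (H₂ →L[ℂ] H₂)}
    (hx : x ∈ gradedPart (π₁.prod π₂) (U₁, U₂) (Set.Icc (-N : ℤ) N)) :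
    ‖x.1‖ ≤ (2 * N + 1) * ‖x.2‖ := by
  rw [← Finset.coe_Icc] at hx
  obtain ⟨c, hc, rfl⟩ := exists_sum_of_mem_gradedPart hx
  rw [Prod.fst_sum, Prod.snd_sum]
  have key (k : ℤ) (hk : k ∈ Finset.Icc (-N : ℤ) N) :
      ‖(c k).1‖ ≤ ‖∑ j ∈ Finset.Icc (-N : ℤ) N, (c j).2‖ := by
    rw [norm_fst_eq_norm_snd_of_homogeneous h₁ h₂ hker (hc k)]
    exact h₂.isCovariantPair.norm_homogeneous_le hstar _ (fun j => (c j).2)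
      (fun j => snd_mem_gradedPart (hc j)) hk
  refine (norm_sum_le_of_le _ key).trans_eq ?_
  have hcard : (Finset.Icc (-N : ℤ) N).card = 2 * N + 1 := by
    rw [Int.card_Icc]
    omega
  rw [Finset.sum_const, hcard, nsmul_eq_mul]
  push_cast
  rfl

theorem norm_mul_star_self_pow_two_pow {B : Type*} [CStarAlgebra B] (y : B) (n : ℕ) :
    ‖(y * star y) ^ 2 ^ n‖ = (‖y‖ * ‖y‖) ^ 2 ^ n := by
  rw [← CStarRing.norm_self_mul_star]
  exact congrArg NNReal.toReal ((IsSelfAdjoint.mul_star_self y).nnnorm_pow_two_pow n)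

theorem norm_fst_le_norm_snd (h₁ : IsCovariantRep δ π₁ U₁) (h₂ : IsCovariantRep δ π₂ U₂)
    (hstar : PropertyStar δ π₂ U₂)
    (hker : ∀ a, star U₁ * U₁ * π₁ a = π₁ a ↔ star U₂ * U₂ * π₂ a = π₂ a)
    {x : (H₁ →L[ℂ] H₁) × (H₂ →L[ℂ] H₂)}
    (hx : x ∈ gradedPart (π₁.prod π₂) (U₁, U₂) Set.univ) : ‖x.1‖ ≤ ‖x.2‖ := by
  have hp := h₁.isCovariantPair.prod h₂.isCovariantPair
  obtain ⟨N, hN⟩ := exists_mem_gradedPart_Icc hx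
  have hxx := hp.mul_mem_gradedPart_Icc hN (star_mem_gradedPart_Icc hN)
  have := le_of_pow_two_pow_le (x := ‖x.1‖ * ‖x.1‖) (y := ‖x.2‖ * ‖x.2‖)
    (c := 2 * ((N + N : ℕ) : ℝ)) (by positivity) fun n => by
      have := norm_fst_le_mul_norm_snd h₁ h₂ hstar hker (hp.pow_mem_gradedPart_Icc hxx (2 ^ n))
      rw [Prod.pow_fst, Prod.pow_snd, Prod.fst_mul, Prod.snd_mul, Prod.fst_star, Prod.snd_star,
        norm_mul_star_self_pow_two_pow, norm_mul_star_self_pow_two_pow] at this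
      convert this using 2
      push_cast
      ring
  exact abs_le_of_sq_le_sq' (by nlinarith) (norm_nonneg _) |>.2

theorem norm_fst_eq_norm_snd_of_mem_adjoin (h₁ : IsCovariantRep δ π₁ U₁)
    (h₂ : IsCovariantRep δ π₂ U₂) (hstar₁ : PropertyStar δ π₁ U₁) (hstar₂ : PropertyStar δ π₂ U₂)
    (hker : ∀ a, star U₁ * U₁ * π₁ a = π₁ a ↔ star U₂ * U₂ * π₂ a = π₂ a)
    {x : (H₁ →L[ℂ] H₁) × (H₂ →L[ℂ] H₂)}
    (hx : x ∈ StarAlgebra.adjoin ℂ (Set.range ⇑(π₁.prod π₂) ∪ {(U₁, U₂)})) :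
    ‖x.1‖ = ‖x.2‖ := by
  have hx' := (h₁.isCovariantPair.prod h₂.isCovariantPair).adjoin_le_gradedPart hx
  refine le_antisymm (norm_fst_le_norm_snd h₁ h₂ hstar₂ hker hx') ?_
  exact norm_fst_le_norm_snd h₂ h₁ hstar₁ (fun a => (hker a).symm)
    (swap_mem_gradedPart hx')

end Comparison

section Graph

variable {B₁ B₂ : Type*} [CStarAlgebra B₁] [CStarAlgebra B₂]

/-- An isometric `⋆`-homomorphism maps the closure of a `⋆`-subalgebra onto the closure of its
image. -/
theorem StarSubalgebra.image_topologicalClosure {B : Type*} [CStarAlgebra B]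
    (f : B →⋆ₐ[ℂ] B₁) (W : StarSubalgebra ℂ B) (hf : Continuous f)
    (hW : ∀ x ∈ W.topologicalClosure, ‖f x‖ = ‖x‖) :
    f '' (W.topologicalClosure : Set B) = ((W.map f).topologicalClosure : Set B₁) := by
  have hcl : IsClosed (W.topologicalClosure : Set B) := W.isClosed_topologicalClosure
  apply Set.Subset.antisymm
  · rw [StarSubalgebra.topologicalClosure_coe, StarSubalgebra.topologicalClosure_coe]
    exact image_closure_subset_closure_image hf
  · have : CompleteSpace W.topologicalClosure := hcl.completeSpace_coe
    let g : W.topologicalClosure →+ B₁ :=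
      (f : B →+ B₁).comp (W.topologicalClosure.toSubalgebra.toSubring.toAddSubgroup.subtype)
    have hg : Isometry g := AddMonoidHomClass.isometry_of_norm g fun x => hW x x.2
    have hr : f '' (W.topologicalClosure : Set B) = Set.range g := by
      ext y
      constructor
      · rintro ⟨x, hx, rfl⟩
        exact ⟨⟨x, hx⟩, rfl⟩
      · rintro ⟨x, rfl⟩
        exact ⟨x, x.2, rfl⟩
    have hc : IsClosed (f '' (W.topologicalClosure : Set B)) := by
      rw [hr]
      exact hg.isClosedEmbedding.isClosed_range
    rw [StarSubalgebra.topologicalClosure_coe (s := W.map f)]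
    refine closure_minimal ?_ hc
    exact Set.image_mono W.le_topologicalClosure

/-- The correspondence given by a `⋆`-subalgebra of a product on which both coordinates have the
same norm is a `⋆`-isomorphism of its projections. -/
theorem StarSubalgebra.exists_bijOn_of_norm_eq (C : StarSubalgebra ℂ (B₁ × B₂))
    (hC : ∀ x ∈ C, ‖x.1‖ = ‖x.2‖) :
    ∃ Φ : B₁ → B₂, (∀ x ∈ C, Φ x.1 = x.2) ∧
      Set.BijOn Φ (Prod.fst '' (C : Set (B₁ × B₂))) (Prod.snd '' (C : Set (B₁ × B₂))) := by
  have uniq {x y : B₁ × B₂} (hx : x ∈ C) (hy : y ∈ C) : x.1 = y.1 ↔ x.2 = y.2 := by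
    have := hC (x - y) (sub_mem hx hy)
    rw [← sub_eq_zero, ← norm_eq_zero, ← Prod.fst_sub, this, norm_eq_zero, Prod.snd_sub,
      sub_eq_zero]
  classical
  let Φ : B₁ → B₂ := fun b => if h : ∃ y, (b, y) ∈ C then h.choose else 0
  have hΦ : ∀ x ∈ C, Φ x.1 = x.2 := fun x hx => by
    have h : ∃ y, (x.1, y) ∈ C := ⟨x.2, hx⟩
    simp only [Φ, dif_pos h]
    exact (uniq (x := (x.1, h.choose)) h.choose_spec hx).1 rfl
  refine ⟨Φ, hΦ, ?_, ?_, ?_⟩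
  · rintro _ ⟨x, hx, rfl⟩
    exact ⟨x, hx, (hΦ x hx).symm⟩
  · rintro _ ⟨x, hx, rfl⟩ _ ⟨y, hy, rfl⟩ h
    rw [hΦ x hx, hΦ y hy] at h
    exact (uniq hx hy).2 h
  · rintro _ ⟨x, hx, rfl⟩
    exact ⟨x.1, ⟨x, hx, rfl⟩, hΦ x hx⟩

end Graph

/-- **Isomorphism Theorem.** If `(π₁,U₁,H₁)` and `(π₂,U₂,H₂)` are
covariant representations of `(A,δ)` both associated with the same ideal `J` and both
possessing property `(*)`, then `π₁(a) ↦ π₂(a)`, `U₁ ↦ U₂` extends to a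
`*`-isomorphism of `C*(π₁(A),U₁)` onto `C*(π₂(A),U₂)`. -/
theorem isomorphism_theorem {A : Type*} [CStarAlgebra A] (δ : A →⋆ₙₐ[ℂ] A)
    (J : Set A)
    {H₁ : Type*} [NormedAddCommGroup H₁] [InnerProductSpace ℂ H₁] [CompleteSpace H₁]
    (π₁ : A →⋆ₐ[ℂ] (H₁ →L[ℂ] H₁)) (U₁ : H₁ →L[ℂ] H₁)
    (hrep₁ : IsCovariantRep δ π₁ U₁) (hstar₁ : PropertyStar δ π₁ U₁)
    (hJ₁ : J = {a : A | star U₁ * U₁ * π₁ a = π₁ a})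
    {H₂ : Type*} [NormedAddCommGroup H₂] [InnerProductSpace ℂ H₂] [CompleteSpace H₂]
    (π₂ : A →⋆ₐ[ℂ] (H₂ →L[ℂ] H₂)) (U₂ : H₂ →L[ℂ] H₂)
    (hrep₂ : IsCovariantRep δ π₂ U₂) (hstar₂ : PropertyStar δ π₂ U₂)
    (hJ₂ : J = {a : A | star U₂ * U₂ * π₂ a = π₂ a}) :
    ∃ Φ : (H₁ →L[ℂ] H₁) → (H₂ →L[ℂ] H₂),
      Set.BijOn Φ
        ((StarAlgebra.adjoin ℂ (Set.range ⇑π₁ ∪ {U₁})).topologicalClosure :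
          Set (H₁ →L[ℂ] H₁))
        ((StarAlgebra.adjoin ℂ (Set.range ⇑π₂ ∪ {U₂})).topologicalClosure :
          Set (H₂ →L[ℂ] H₂)) ∧
      (∀ x ∈ ((StarAlgebra.adjoin ℂ (Set.range ⇑π₁ ∪ {U₁})).topologicalClosure :
          Set (H₁ →L[ℂ] H₁)),
        ∀ y ∈ ((StarAlgebra.adjoin ℂ (Set.range ⇑π₁ ∪ {U₁})).topologicalClosure :
          Set (H₁ →L[ℂ] H₁)),
        Φ (x + y) = Φ x + Φ y ∧ Φ (x * y) = Φ x * Φ y) ∧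
      (∀ (z : ℂ),
        ∀ x ∈ ((StarAlgebra.adjoin ℂ (Set.range ⇑π₁ ∪ {U₁})).topologicalClosure :
          Set (H₁ →L[ℂ] H₁)), Φ (z • x) = z • Φ x) ∧
      (∀ x ∈ ((StarAlgebra.adjoin ℂ (Set.range ⇑π₁ ∪ {U₁})).topologicalClosure :
          Set (H₁ →L[ℂ] H₁)), Φ (star x) = star (Φ x)) ∧
      (∀ a : A, Φ (π₁ a) = π₂ a) ∧
      Φ U₁ = U₂ := by
  have hker (a : A) : star U₁ * U₁ * π₁ a = π₁ a ↔ star U₂ * U₂ * π₂ a = π₂ a :=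
    Set.ext_iff.1 (hJ₁.symm.trans hJ₂) a
  let W := StarAlgebra.adjoin ℂ (Set.range ⇑(π₁.prod π₂) ∪ {(U₁, U₂)})
  let C := W.topologicalClosure
  have hC : ∀ x ∈ C, ‖x.1‖ = ‖x.2‖ := fun x hx =>
    closure_minimal (t := {x : (H₁ →L[ℂ] H₁) × (H₂ →L[ℂ] H₂) | ‖x.1‖ = ‖x.2‖})
      (fun x hx => norm_fst_eq_norm_snd_of_mem_adjoin hrep₁ hrep₂ hstar₁ hstar₂ hker hx)
      (isClosed_eq (by fun_prop) (by fun_prop)) hx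
  have hfst : Prod.fst '' (C : Set ((H₁ →L[ℂ] H₁) × (H₂ →L[ℂ] H₂))) =
      ((StarAlgebra.adjoin ℂ (Set.range ⇑π₁ ∪ {U₁})).topologicalClosure :
        Set (H₁ →L[ℂ] H₁)) := by
    have e := W.image_topologicalClosure (StarAlgHom.fst ℂ (H₁ →L[ℂ] H₁) (H₂ →L[ℂ] H₂))
      continuous_fst fun x hx => by
        rw [Prod.norm_def, ← hC x hx, max_self]
        rfl
    rw [StarAlgHom.map_adjoin, Set.image_union, Set.image_singleton, ← Set.range_comp] at e
    exact e
  have hsnd : Prod.snd '' (C : Set ((H₁ →L[ℂ] H₁) × (H₂ →L[ℂ] H₂))) =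
      ((StarAlgebra.adjoin ℂ (Set.range ⇑π₂ ∪ {U₂})).topologicalClosure :
        Set (H₂ →L[ℂ] H₂)) := by
    have e := W.image_topologicalClosure (StarAlgHom.snd ℂ (H₁ →L[ℂ] H₁) (H₂ →L[ℂ] H₂))
      continuous_snd fun x hx => by
        rw [Prod.norm_def, hC x hx, max_self]
        rfl
    rw [StarAlgHom.map_adjoin, Set.image_union, Set.image_singleton, ← Set.range_comp] at e
    exact e
  obtain ⟨Φ, hΦ, hbij⟩ := C.exists_bijOn_of_norm_eq hC
  rw [hfst, hsnd] at hbij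
  have lift {x : H₁ →L[ℂ] H₁}
      (hx : x ∈ (StarAlgebra.adjoin ℂ (Set.range ⇑π₁ ∪ {U₁})).topologicalClosure) :
      ∃ p ∈ C, p.1 = x := by
    rw [← SetLike.mem_coe, ← hfst] at hx
    exact hx
  have hWC : ∀ x ∈ W, x ∈ C := fun x hx => W.le_topologicalClosure hx
  refine ⟨Φ, hbij, fun x hx y hy => ?_, fun z x hx => ?_, fun x hx => ?_, fun a => ?_, ?_⟩
  · obtain ⟨p, hp, rfl⟩ := lift hx
    obtain ⟨q, hq, rfl⟩ := lift hy
    rw [hΦ p hp, hΦ q hq]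
    exact ⟨hΦ (p + q) (add_mem hp hq), hΦ (p * q) (mul_mem hp hq)⟩
  · obtain ⟨p, hp, rfl⟩ := lift hx
    rw [hΦ p hp]
    exact hΦ (z • p) (SMulMemClass.smul_mem z hp)
  · obtain ⟨p, hp, rfl⟩ := lift hx
    rw [hΦ p hp]
    exact hΦ (star p) (star_mem hp)
  · exact hΦ (π₁ a, π₂ a) (hWC _ (StarAlgebra.subset_adjoin ℂ _ (Or.inl ⟨a, rfl⟩)))
  · exact hΦ (U₁, U₂) (hWC _ (StarAlgebra.subset_adjoin ℂ _ (Or.inr rfl)))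
end
end
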